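/- arXiv:1012.3918 — 13 statements merged into one kernel-verified Lean document; each statement's English description precedes it below -/
import Mathlib

section
/- For every integer d ≥ 2 there exists a constant c_d > 0 such that for every positive integer m, every family F of m distinct finite sets contains a B_d-free subfamily of size at least c_d · m^{e_d}, where e_d = (2^d − ⌈log₂(d+2)⌉)/(2^d − 1). -/
/-- A family `B` of finite sets forms a Boolean algebra of dimension `d`:
its members can be indexed by subsets of `[d]` so that unions and
intersections of members correspond to unions and intersections of indices. -/
def IsBooleanAlgebraDim {α : Type*} [DecidableEq α] (d : ℕ) (B : Finset (Finset α)) : Prop :=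
  ∃ f : Finset (Fin d) → Finset α, Function.Injective f ∧
    (∀ I J : Finset (Fin d), f (I ∪ J) = f I ∪ f J ∧ f (I ∩ J) = f I ∩ f J) ∧
    B = Finset.image f Finset.univ

/-- A family is `B_d`-free if no subfamily forms a Boolean algebra of dimension `d`. -/
def IsBdFree {α : Type*} [DecidableEq α] (d : ℕ) (F : Finset (Finset α)) : Prop :=
  ∀ B ⊆ F, ¬ IsBooleanAlgebraDim d B

open Finset in
/-- Few colourings are constant on a given nonempty set. -/
theorem card_monochromatic_mul_le {V : Type*} [Fintype V] [DecidableEq V] (k : ℕ)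
    (e : Finset V) (he : e.Nonempty) :
    #{χ : V → Fin k | ∀ x ∈ e, ∀ y ∈ e, χ x = χ y} * k ^ (#e - 1) ≤ k ^ Fintype.card V := by
  obtain ⟨a, ha⟩ := he
  have h1 : k ^ (#e - 1) = #(univ : Finset (↥(e.erase a) → Fin k)) := by
    rw [Finset.card_univ, Fintype.card_fun, Fintype.card_fin, Fintype.card_coe, card_erase_of_mem ha]
  have h2 : k ^ Fintype.card V = #(univ : Finset (V → Fin k)) := by
    rw [Finset.card_univ, Fintype.card_fun, Fintype.card_fin]
  rw [h1, h2, ← card_product]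
  refine card_le_card_of_injOn
    (fun p x => if hx : x ∈ e.erase a then p.2 ⟨x, hx⟩ else p.1 x) (fun _ _ => by simp) ?_
  rintro ⟨χ, g⟩ hp ⟨χ', g'⟩ hp' h
  simp only [coe_product, Set.mem_prod, mem_coe, mem_filter, mem_univ, true_and, and_true] at hp hp'
  have hg : g = g' := by
    funext ⟨x, hx⟩
    simpa only [hx, dite_true] using congrFun h x
  have hout : ∀ x, x ∉ e.erase a → χ x = χ' x := fun x hx => by
    simpa only [hx, dite_false] using congrFun h x
  have hχ : χ = χ' := by
    funext x
    by_cases hx : x ∈ e.erase a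
    · have hxe := mem_of_mem_erase hx
      rw [hp x hxe a ha, hp' x hxe a ha]
      exact hout a (notMem_erase a e)
    · exact hout x hx
  rw [hg, hχ]

open Finset in
/-- Deletion method: deleting a vertex from each edge inside `C` leaves an independent set. -/
theorem exists_independent_subset {V : Type*} [DecidableEq V] (E : Finset (Finset V))
    (hE : ∀ e ∈ E, e.Nonempty) (C : Finset V) :
    ∃ G ⊆ C, (∀ e ∈ E, ¬ e ⊆ G) ∧ #C ≤ #G + #{e ∈ E | e ⊆ C} := by
  have hE' : ∀ e : E, ∃ x, x ∈ e.1 := fun e => hE e.1 e.2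
  choose v hv using hE'
  refine ⟨C \ ({e ∈ E.attach | e.1 ⊆ C}).image v, sdiff_subset, fun e he h => ?_, ?_⟩
  · have := h (hv ⟨e, he⟩)
    rw [mem_sdiff, mem_image] at this
    exact this.2 ⟨⟨e, he⟩, mem_filter.2 ⟨mem_attach _ _, h.trans sdiff_subset⟩, rfl⟩
  · have h1 := le_card_sdiff (({e ∈ E.attach | e.1 ⊆ C}).image v) C
    have h2 := card_image_le (s := {e ∈ E.attach | e.1 ⊆ C}) (f := v)
    have h3 : #{e ∈ E.attach | e.1 ⊆ C} ≤ #{e ∈ E | e ⊆ C} :=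
      card_le_card_of_injOn Subtype.val
        (fun e he => mem_filter.2 ⟨e.2, (mem_filter.1 he).2⟩) Subtype.val_injective.injOn
    omega

open Finset in
/-- A large independent set in a uniform hypergraph, found as a part of a colour class. -/
theorem exists_large_independent {V : Type*} [Fintype V] [DecidableEq V] {r k : ℕ} (hr : 0 < r)
    (hk : 0 < k) (E : Finset (Finset V)) (hE : ∀ e ∈ E, #e = r)
    (h : 2 * #E ≤ k ^ (r - 1) * Fintype.card V) :
    ∃ G : Finset V, (∀ e ∈ E, ¬ e ⊆ G) ∧ Fintype.card V ≤ 2 * k * #G := by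
  have hne : ∀ e ∈ E, e.Nonempty := fun e he => card_pos.1 (by rw [hE e he]; exact hr)
  have : NeZero k := ⟨hk.ne'⟩
  set n := Fintype.card V with hn
  let mono : (V → Fin k) → Finset (Finset V) := fun χ =>
    {e ∈ E | ∀ x ∈ e, ∀ y ∈ e, χ x = χ y}
  obtain ⟨χ, -, hχ⟩ : ∃ χ ∈ (univ : Finset (V → Fin k)), 2 * #(mono χ) ≤ n := by
    refine exists_le_of_sum_le univ_nonempty ?_
    rw [sum_const, Finset.card_univ, Fintype.card_fun, Fintype.card_fin, smul_eq_mul, ← hn,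
      ← mul_sum]
    have hswap : ∑ χ, #(mono χ) = ∑ e ∈ E, #{χ : V → Fin k | ∀ x ∈ e, ∀ y ∈ e, χ x = χ y} :=
      sum_card_bipartiteAbove_eq_sum_card_bipartiteBelow
        (fun (χ : V → Fin k) (e : Finset V) => ∀ x ∈ e, ∀ y ∈ e, χ x = χ y)
    have hle : (∑ χ, #(mono χ)) * k ^ (r - 1) ≤ #E * k ^ n := by
      rw [hswap, sum_mul, ← smul_eq_mul, ← sum_const]
      refine sum_le_sum fun e he => ?_
      rw [← hE e he]
      exact card_monochromatic_mul_le k e (hne e he)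
    refine le_of_mul_le_mul_right ?_ (pow_pos hk (r - 1))
    calc 2 * (∑ χ, #(mono χ)) * k ^ (r - 1) = 2 * ((∑ χ, #(mono χ)) * k ^ (r - 1)) := by ring
      _ ≤ 2 * (#E * k ^ n) := by gcongr
      _ = (2 * #E) * k ^ n := by ring
      _ ≤ (k ^ (r - 1) * n) * k ^ n := by gcongr
      _ = k ^ n * n * k ^ (r - 1) := by ring
  let C : Fin k → Finset V := fun c => {x | χ x = c}
  obtain ⟨c, -, hc⟩ : ∃ c ∈ (univ : Finset (Fin k)),
      n + 2 * k * #{e ∈ E | e ⊆ C c} ≤ 2 * k * #(C c) := by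
    refine exists_le_of_sum_le univ_nonempty ?_
    have hC : ∑ c, #(C c) = n :=
      (card_eq_sum_card_fiberwise (f := χ) (s := univ) (t := univ) (fun _ _ => by simp)).symm
    have hM : ∑ c, #{e ∈ E | e ⊆ C c} ≤ #(mono χ) := by
      rw [← card_biUnion]
      · refine card_le_card fun e he => ?_
        simp only [mem_biUnion, mem_filter, mem_univ, true_and, mono] at he ⊢
        obtain ⟨c, he, hc⟩ := he
        refine ⟨he, fun x hx y hy => ?_⟩
        rw [(mem_filter.1 (hc hx)).2, (mem_filter.1 (hc hy)).2]
      · intro c _ c' _ hcc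
        refine disjoint_left.2 fun e he he' => hcc ?_
        rw [mem_filter] at he he'
        obtain ⟨x, hx⟩ := hne e he.1
        rw [← (mem_filter.1 (he.2 hx)).2, ← (mem_filter.1 (he'.2 hx)).2]
    rw [sum_add_distrib, ← mul_sum, ← mul_sum, hC, sum_const, Finset.card_univ, Fintype.card_fin,
      smul_eq_mul]
    have := Nat.mul_le_mul_left k (Nat.mul_le_mul_left 2 hM)
    have := Nat.mul_le_mul_left k hχ
    nlinarith
  obtain ⟨G, -, hG, hcard⟩ := exists_independent_subset E hne (C c)
  refine ⟨G, hG, ?_⟩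
  have := Nat.mul_le_mul_left (2 * k) hcard
  rw [mul_add] at this
  omega

/-- Membership of a point in the members of an indexed Boolean algebra follows one of
three patterns. -/
theorem mem_boolean_cases {α : Type*} [DecidableEq α] {d : ℕ} {f : Finset (Fin d) → Finset α}
    (hf : ∀ I J : Finset (Fin d), f (I ∪ J) = f I ∪ f J ∧ f (I ∩ J) = f I ∩ f J) (x : α) :
    (∀ J, x ∈ f J) ∨ (∀ J, x ∉ f J) ∨ ∃ j, ∀ J, x ∈ f J ↔ j ∈ J := by
  have hmono : ∀ {I J}, I ⊆ J → f I ⊆ f J := fun {I J} h => by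
    rw [← Finset.union_eq_right.2 h, (hf I J).1]
    exact Finset.subset_union_left
  by_cases h0 : x ∈ f ∅
  · exact Or.inl fun J => hmono (Finset.empty_subset J) h0
  have key : ∀ J, x ∈ f J → ∃ j ∈ J, x ∈ f {j} := by
    intro J
    induction J using Finset.induction_on with
    | empty => exact fun h => absurd h h0
    | insert a s _ ih =>
      intro h
      rw [Finset.insert_eq, (hf _ _).1, Finset.mem_union] at h
      rcases h with h | h
      · exact ⟨a, Finset.mem_insert_self _ _, h⟩
      · obtain ⟨j, hj, hx⟩ := ih h
        exact ⟨j, Finset.mem_insert_of_mem hj, hx⟩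
  by_cases h1 : ∃ J, x ∈ f J
  · obtain ⟨J, hJ⟩ := h1
    obtain ⟨j, -, hj⟩ := key J hJ
    refine Or.inr (Or.inr ⟨j, fun K => ⟨fun hK => ?_, fun hK =>
      hmono (Finset.singleton_subset_iff.2 hK) hj⟩⟩)
    by_contra hjK
    apply h0
    rw [← Finset.singleton_inter_of_notMem hjK, (hf _ _).2]
    exact Finset.mem_inter.2 ⟨hj, hK⟩
  · exact Or.inr (Or.inl fun J hJ => h1 ⟨J, hJ⟩)

/-- An indexed Boolean algebra is determined by its members at a separating family of indices. -/
theorem boolean_eq_of_separating {α : Type*} [DecidableEq α] {d t : ℕ} (ht : 0 < t)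
    (v : Fin d → Finset (Fin t)) (hv : Function.Injective v) (h0 : ∀ j, v j ≠ ∅)
    (h1 : ∀ j, v j ≠ Finset.univ) {f g : Finset (Fin d) → Finset α}
    (hf : ∀ I J : Finset (Fin d), f (I ∪ J) = f I ∪ f J ∧ f (I ∩ J) = f I ∩ f J)
    (hg : ∀ I J : Finset (Fin d), g (I ∪ J) = g I ∪ g J ∧ g (I ∩ J) = g I ∩ g J)
    (hfg : ∀ i : Fin t, f {j | i ∈ v j} = g {j | i ∈ v j}) : f = g := by
  funext J
  ext x
  have hx : ∀ i : Fin t, x ∈ f {j | i ∈ v j} ↔ x ∈ g {j | i ∈ v j} := fun i => by rw [hfg]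
  rcases mem_boolean_cases hf x with hf | hf | ⟨j, hf⟩ <;>
    rcases mem_boolean_cases hg x with hg | hg | ⟨j', hg⟩ <;>
    simp only [hf, hg, Finset.mem_filter, Finset.mem_univ, true_and, true_iff, iff_true,
      false_iff, iff_false] at hx ⊢
  · exact hx ⟨0, ht⟩
  · exact absurd (Finset.eq_univ_of_forall hx) (h1 j')
  · exact hx ⟨0, ht⟩
  · exact absurd (Finset.eq_empty_of_forall_notMem hx) (h0 j')
  · exact absurd (Finset.eq_univ_of_forall hx) (h1 j)
  · exact absurd (Finset.eq_empty_of_forall_notMem hx) (h0 j)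
  · rw [hv (Finset.ext hx)]

open Finset in
theorem exists_separating {d t : ℕ} (h : d + 2 ≤ 2 ^ t) :
    ∃ v : Fin d → Finset (Fin t), Function.Injective v ∧ (∀ j, v j ≠ ∅) ∧
      ∀ j, v j ≠ Finset.univ := by
  let S : Finset (Finset (Fin t)) := (univ.erase ∅).erase univ
  have hS : Fintype.card (Fin d) ≤ Fintype.card S := by
    have h1 := pred_card_le_card_erase (s := (univ : Finset (Finset (Fin t)))) (a := ∅)
    have h2 := pred_card_le_card_erase (s := (univ : Finset (Finset (Fin t))).erase ∅) (a := univ)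
    rw [Finset.card_univ, Fintype.card_finset, Fintype.card_fin] at h1
    rw [Fintype.card_fin, Fintype.card_coe]
    change d ≤ #((univ.erase ∅).erase univ)
    omega
  obtain ⟨w⟩ := Function.Embedding.nonempty_of_card_le hS
  refine ⟨fun j => (w j).1, Subtype.val_injective.comp w.injective, fun j => ?_, fun j => ?_⟩
  · exact (mem_erase.1 (mem_erase.1 (w j).2).2).1
  · exact (mem_erase.1 (w j).2).1

open Finset in
/-- The number of Boolean algebras of dimension `d` in a family of `m` sets is at most `m ^ t`
whenever `d + 2 ≤ 2 ^ t`. -/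
theorem card_booleanAlgebras_le {α : Type*} [DecidableEq α] {d t : ℕ} (ht : d + 2 ≤ 2 ^ t)
    (F : Finset (Finset α)) (E : Finset (Finset F))
    (hE : ∀ e ∈ E, IsBooleanAlgebraDim d (e.map (Function.Embedding.subtype _))) :
    #E ≤ #F ^ t := by
  have ht0 : 0 < t := by
    rcases Nat.eq_zero_or_pos t with rfl | h
    · simp at ht
    · exact h
  obtain ⟨v, hv, h0, h1⟩ := exists_separating ht
  choose! f _ hf hB using hE
  have hmem : ∀ e ∈ E, ∀ J, f e J ∈ F := fun e he J => by
    have : f e J ∈ e.map (Function.Embedding.subtype _) := by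
      rw [hB e he]
      exact mem_image_of_mem _ (mem_univ _)
    obtain ⟨y, -, hy⟩ := mem_map.1 this
    exact hy ▸ y.2
  have hcard : #F ^ t = #(Fintype.piFinset fun _ : Fin t => F) := by simp
  rw [hcard]
  refine card_le_card_of_injOn (fun e i => f e {j | i ∈ v j})
    (fun e he => Fintype.mem_piFinset.2 fun i => hmem e he _) fun e he e' he' h => ?_
  have := boolean_eq_of_separating ht0 v hv h0 h1 (hf e he) (hf e' he') (congrFun h)
  apply map_injective (Function.Embedding.subtype _)
  rw [hB e he, hB e' he', this]

open Finset in
/-- Boolean algebras of dimension `d` have `2 ^ d` members. -/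
theorem IsBooleanAlgebraDim.card_eq {α : Type*} [DecidableEq α] {d : ℕ} {B : Finset (Finset α)}
    (h : IsBooleanAlgebraDim d B) : #B = 2 ^ d := by
  obtain ⟨f, hf, -, rfl⟩ := h
  rw [card_image_of_injective _ hf, Finset.card_univ, Fintype.card_finset, Fintype.card_fin]

open Finset in
theorem exists_large_bdFree {α : Type*} [DecidableEq α] {d t k : ℕ} (ht : d + 2 ≤ 2 ^ t)
    (hk : 0 < k) (F : Finset (Finset α)) (h : 2 * #F ^ t ≤ k ^ (2 ^ d - 1) * #F) :
    ∃ G ⊆ F, IsBdFree d G ∧ #F ≤ 2 * k * #G := by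
  classical
  let E : Finset (Finset F) := {e | IsBooleanAlgebraDim d (e.map (Function.Embedding.subtype _))}
  have hE : ∀ e ∈ E, IsBooleanAlgebraDim d (e.map (Function.Embedding.subtype _)) :=
    fun e he => (mem_filter.1 he).2
  obtain ⟨G, hG, hcard⟩ := exists_large_independent (pow_pos two_pos d) hk E
    (fun e he => by rw [← (hE e he).card_eq, card_map])
    ((Nat.mul_le_mul_left 2 (card_booleanAlgebras_le ht F E hE)).trans
      (by rwa [Fintype.card_coe]))
  refine ⟨G.map (Function.Embedding.subtype _), fun x hx => ?_, fun B hB hBool => ?_, ?_⟩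
  · obtain ⟨y, -, rfl⟩ := mem_map.1 hx
    exact y.2
  · obtain ⟨e, he, rfl⟩ := subset_map_iff.1 hB
    exact hG e (mem_filter.2 ⟨mem_univ _, hBool⟩) he
  · rwa [card_map, ← Fintype.card_coe]

theorem bd_free_lower_bound (d : ℕ) (hd : 2 ≤ d) :
    ∃ c : ℝ, 0 < c ∧
      ∀ (α : Type) [DecidableEq α] (m : ℕ), 0 < m →
        ∀ F : Finset (Finset α), F.card = m →
          ∃ G ⊆ F, IsBdFree d G ∧
            c * (m : ℝ) ^ (((2 ^ d : ℝ) - (Nat.clog 2 (d + 2) : ℝ)) / ((2 ^ d : ℝ) - 1))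
              ≤ (G.card : ℝ) := by
  refine ⟨1 / 6, by norm_num, fun α _ m hm F hF => ?_⟩
  have ht : d + 2 ≤ 2 ^ Nat.clog 2 (d + 2) := Nat.le_pow_clog one_lt_two _
  obtain ⟨s, hs⟩ : ∃ s, Nat.clog 2 (d + 2) = s + 1 :=
    Nat.exists_eq_succ_of_ne_zero (Nat.clog_pos one_lt_two (by omega)).ne'
  rw [hs] at ht ⊢
  obtain ⟨q, hq⟩ : ∃ q, 2 ^ d = q + 1 :=
    Nat.exists_eq_succ_of_ne_zero (pow_pos two_pos d).ne'
  have hq0 : q ≠ 0 := by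
    rintro rfl
    have := Nat.pow_le_pow_right two_pos hd
    omega
  have hqR : (2 ^ d : ℝ) = q + 1 := by exact_mod_cast hq
  have hq0R : (q : ℝ) ≠ 0 := by exact_mod_cast hq0
  have hm1 : (1 : ℝ) ≤ m := by exact_mod_cast hm
  have hm0 : (0 : ℝ) < m := by linarith
  set y : ℝ := (m : ℝ) ^ ((s : ℝ) / q) with hy
  have hy1 : 1 ≤ y := Real.one_le_rpow hm1 (by positivity)
  have hyq : y ^ q = (m : ℝ) ^ s := by
    rw [hy, ← Real.rpow_natCast, ← Real.rpow_mul hm0.le, div_mul_cancel₀ _ hq0R,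
      Real.rpow_natCast]
  set k := ⌈2 * y⌉₊ with hk
  have hky : 2 * y ≤ k := Nat.le_ceil _
  have hky' : (k : ℝ) < 2 * y + 1 := Nat.ceil_lt_add_one (by linarith)
  have hk0 : 0 < k := Nat.ceil_pos.2 (by linarith)
  have hpow : 2 * m ^ s ≤ k ^ q := by
    have : (2 : ℝ) * (m : ℝ) ^ s ≤ (k : ℝ) ^ q := calc
      (2 : ℝ) * (m : ℝ) ^ s ≤ 2 ^ q * y ^ q := by
        rw [hyq]
        gcongr
        exact le_self_pow₀ one_le_two hq0
      _ = (2 * y) ^ q := (mul_pow _ _ _).symm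
      _ ≤ (k : ℝ) ^ q := by gcongr
    exact_mod_cast this
  obtain ⟨G, hGF, hG, hcard⟩ := exists_large_bdFree (d := d) ht hk0 F (by
    rw [hF, hq, Nat.add_sub_cancel, pow_succ, ← mul_assoc]
    exact Nat.mul_le_mul_right m hpow)
  refine ⟨G, hGF, hG, ?_⟩
  have hexp : ((2 ^ d : ℝ) - ((s + 1 : ℕ) : ℝ)) / ((2 ^ d : ℝ) - 1) = 1 - (s : ℝ) / q := by
    rw [hqR, add_sub_cancel_right, eq_sub_iff_add_eq, ← add_div, div_eq_one_iff_eq hq0R]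
    push_cast
    ring
  rw [hexp, Real.rpow_sub hm0, Real.rpow_one, ← hy]
  have hcardR : (m : ℝ) ≤ 2 * k * G.card := by
    rw [hF] at hcard
    exact_mod_cast hcard
  have hG0 : (0 : ℝ) ≤ G.card := Nat.cast_nonneg _
  have hfinal : (m : ℝ) / y ≤ 6 * G.card := by
    rw [div_le_iff₀ (by linarith)]
    nlinarith
  linarith
end

section
/- For every integer d ≥ 2 and every integer k ≥ 2 there exists a family F of k^{2^d − 1} distinct finite sets such that every B_d-free subfamily of F has size at most 2 · k^{2^d − 2}. -/
/-- The grid whose `i`-th side is a chain with `k ^ 2 ^ i` elements. -/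
def grid (k d : ℕ) : Finset (Fin d → ℕ) :=
  Fintype.piFinset fun i => Finset.range (k ^ 2 ^ (i : ℕ))

/-- The boxes of the grid, given by a pair of increasing coordinates on every side. -/
def gridBoxes (k d : ℕ) : Finset (Fin d → ℕ × ℕ) :=
  Fintype.piFinset fun i =>
    (Finset.range (k ^ 2 ^ (i : ℕ)) ×ˢ Finset.range (k ^ 2 ^ (i : ℕ))).filter fun q => q.1 < q.2

/-- The corner of a box that takes the upper coordinate exactly on the sides in `I`. -/
def boxCorner {d : ℕ} (p : Fin d → ℕ × ℕ) (I : Finset (Fin d)) : Fin d → ℕ :=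
  fun i => if i ∈ I then (p i).2 else (p i).1

theorem card_grid_succ (k d : ℕ) : (grid k (d + 1)).card = (grid k d).card * k ^ 2 ^ d := by
  simp [grid, Fintype.card_piFinset, Fin.prod_univ_castSucc]

theorem mul_card_grid (k d : ℕ) : k * (grid k d).card = k ^ 2 ^ d := by
  induction d with
  | zero => simp [grid]
  | succ d ih => rw [card_grid_succ, ← mul_assoc, ih, ← pow_add, pow_succ, mul_two]

theorem card_grid {k : ℕ} (hk : 0 < k) (d : ℕ) : (grid k d).card = k ^ (2 ^ d - 1) := by
  apply Nat.eq_of_mul_eq_mul_left hk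
  rw [mul_card_grid, ← pow_succ', Nat.sub_add_cancel Nat.one_le_two_pow]

theorem two_mul_card_filter_lt_le (n : ℕ) :
    2 * ((Finset.range n ×ˢ Finset.range n).filter fun q => q.1 < q.2).card ≤ n * n := by
  set s := Finset.range n ×ˢ Finset.range n with hs
  have hswap : (s.filter fun q => q.1 < q.2).card = (s.filter fun q => q.2 < q.1).card :=
    Finset.card_nbij' Prod.swap Prod.swap (by simp +contextual [hs, Set.MapsTo])
      (by simp +contextual [hs, Set.MapsTo]) (by simp [Set.LeftInvOn])
      (by simp [Set.LeftInvOn, Set.RightInvOn])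
  have hdisj : Disjoint (s.filter fun q => q.1 < q.2) (s.filter fun q => q.2 < q.1) :=
    Finset.disjoint_filter.2 fun q _ h => h.le.not_gt
  calc 2 * (s.filter fun q => q.1 < q.2).card
      = ((s.filter fun q => q.1 < q.2) ∪ s.filter fun q => q.2 < q.1).card := by
        rw [Finset.card_union_of_disjoint hdisj, ← hswap, two_mul]
    _ ≤ s.card := Finset.card_le_card
        (Finset.union_subset (Finset.filter_subset _ _) (Finset.filter_subset _ _))
    _ = n * n := by simp [hs]

theorem two_pow_mul_card_gridBoxes_le (k d : ℕ) :
    2 ^ d * (gridBoxes k d).card ≤ (grid k d).card * (grid k d).card := by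
  have h2 : (2 : ℕ) ^ d = ∏ _i : Fin d, 2 := by simp
  rw [gridBoxes, grid, Fintype.card_piFinset, Fintype.card_piFinset, h2,
    ← Finset.prod_mul_distrib, ← Finset.prod_mul_distrib]
  refine Finset.prod_le_prod' fun i _ => ?_
  simpa using two_mul_card_filter_lt_le (k ^ 2 ^ (i : ℕ))

theorem boxCorner_snoc {d : ℕ} (p : Fin d → ℕ × ℕ) (v w : ℕ) (I : Finset (Fin (d + 1))) :
    boxCorner (Fin.snoc p (v, w) : Fin (d + 1) → ℕ × ℕ) I =
      (Fin.snoc (boxCorner p (Finset.univ.filter fun i => i.castSucc ∈ I))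
        (if Fin.last d ∈ I then w else v) : Fin (d + 1) → ℕ) := by
  funext i
  refine Fin.lastCases ?_ (fun j => ?_) i <;> simp [boxCorner]

theorem snoc_mem_gridBoxes {k d v w : ℕ} {p : Fin d → ℕ × ℕ} (hp : p ∈ gridBoxes k d)
    (hvw : v < w) (hw : w < k ^ 2 ^ d) :
    (Fin.snoc p (v, w) : Fin (d + 1) → ℕ × ℕ) ∈ gridBoxes k (d + 1) := by
  rw [gridBoxes, Fintype.mem_piFinset] at hp ⊢
  refine Fin.lastCases ?_ (fun j => ?_)
  · simp [hvw, hw, hvw.trans hw]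
  · simpa using hp j

/-- The points `x` such that appending the last coordinate `v` to `x` gives a point of `G`. -/
def lastSlice {d : ℕ} (G : Finset (Fin (d + 1) → ℕ)) (v : ℕ) : Finset (Fin d → ℕ) :=
  (G.filter fun x => x (Fin.last d) = v).image Fin.init

theorem mem_lastSlice {d : ℕ} {G : Finset (Fin (d + 1) → ℕ)} {v : ℕ} {x : Fin d → ℕ} :
    x ∈ lastSlice G v ↔ (Fin.snoc x v : Fin (d + 1) → ℕ) ∈ G := by
  rw [lastSlice, Finset.mem_image]
  constructor
  · rintro ⟨y, hy, rfl⟩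
    obtain ⟨hyG, rfl⟩ := Finset.mem_filter.1 hy
    rwa [Fin.snoc_init_self]
  · intro h
    exact ⟨_, Finset.mem_filter.2 ⟨h, by simp⟩, by simp⟩

theorem card_eq_sum_card_lastSlice {k d : ℕ} {G : Finset (Fin (d + 1) → ℕ)}
    (hG : G ⊆ grid k (d + 1)) :
    G.card = ∑ v ∈ Finset.range (k ^ 2 ^ d), (lastSlice G v).card := by
  have hmaps : ∀ x ∈ G, x (Fin.last d) ∈ Finset.range (k ^ 2 ^ d) := fun x hx => by
    simpa using Fintype.mem_piFinset.1 (hG hx) (Fin.last d)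
  rw [Finset.card_eq_sum_card_fiberwise hmaps]
  refine Finset.sum_congr rfl fun v _ => (Finset.card_image_of_injOn fun x hx y hy hxy => ?_).symm
  have hx' := (Finset.mem_filter.1 hx).2
  have hy' := (Finset.mem_filter.1 hy).2
  rw [← Fin.snoc_init_self x, ← Fin.snoc_init_self y, hxy, hx', hy']

theorem lastSlice_subset_grid {k d : ℕ} {G : Finset (Fin (d + 1) → ℕ)}
    (hG : G ⊆ grid k (d + 1)) (v : ℕ) : lastSlice G v ⊆ grid k d := by
  intro x hx
  have h := Fintype.mem_piFinset.1 (hG (mem_lastSlice.1 hx))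
  exact Fintype.mem_piFinset.2 fun i => by simpa using h i.castSucc

/-- The boxes of the grid all of whose corners lie in `G`. -/
def boxesIn (k : ℕ) {d : ℕ} (G : Finset (Fin d → ℕ)) : Finset (Fin d → ℕ × ℕ) :=
  (gridBoxes k d).filter fun p => ∀ I, boxCorner p I ∈ G

theorem exists_boxFree_subset (k : ℕ) {d : ℕ} (G : Finset (Fin d → ℕ)) :
    ∃ H ⊆ G, boxesIn k H = ∅ ∧ G.card ≤ H.card + (boxesIn k G).card := by
  refine ⟨G \ (boxesIn k G).image fun p => boxCorner p ∅, Finset.sdiff_subset, ?_, ?_⟩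
  · refine Finset.filter_eq_empty_iff.2 fun p hp hcorner => ?_
    refine (Finset.mem_sdiff.1 (hcorner ∅)).2 (Finset.mem_image_of_mem _ ?_)
    exact Finset.mem_filter.2 ⟨hp, fun I => (Finset.mem_sdiff.1 (hcorner I)).1⟩
  · exact (Finset.card_le_card_sdiff_add_card).trans
      (Nat.add_le_add_left Finset.card_image_le _)

theorem sum_card_boxesIn_lastSlice_le {k d : ℕ} {G : Finset (Fin (d + 1) → ℕ)}
    (hfree : boxesIn k G = ∅) :
    ∑ v ∈ Finset.range (k ^ 2 ^ d), (boxesIn k (lastSlice G v)).card ≤ (gridBoxes k d).card := by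
  have key : ∀ v w, v < w → w < k ^ 2 ^ d →
      Disjoint (boxesIn k (lastSlice G v)) (boxesIn k (lastSlice G w)) := by
    intro v w hvw hw
    refine Finset.disjoint_left.2 fun p hpv hpw => ?_
    obtain ⟨hp, hpv⟩ := Finset.mem_filter.1 hpv
    obtain ⟨-, hpw⟩ := Finset.mem_filter.1 hpw
    refine Finset.filter_eq_empty_iff.1 hfree (snoc_mem_gridBoxes hp hvw hw) fun I => ?_
    rw [boxCorner_snoc]
    split_ifs
    · exact mem_lastSlice.1 (hpw _)
    · exact mem_lastSlice.1 (hpv _)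
  rw [← Finset.card_biUnion]
  · exact Finset.card_le_card (Finset.biUnion_subset.2 fun v _ => Finset.filter_subset _ _)
  · intro v hv w hw hne
    rcases hne.lt_or_gt with h | h
    · exact key v w h (Finset.mem_range.1 hw)
    · exact (key w v h (Finset.mem_range.1 hv)).symm

theorem card_boxFree_le (k d : ℕ) (G : Finset (Fin d → ℕ)) (hG : G ⊆ grid k d)
    (hfree : boxesIn k G = ∅) :
    2 ^ d * k * G.card + 2 * (grid k d).card ≤ 2 * 2 ^ d * (grid k d).card := by
  induction d with
  | zero =>
    have hempty : G = ∅ := by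
      refine Finset.eq_empty_of_forall_notMem fun x hx => ?_
      have hmem : (fun i => i.elim0 : Fin 0 → ℕ × ℕ) ∈ gridBoxes k 0 :=
        Fintype.mem_piFinset.2 fun i => i.elim0
      refine Finset.filter_eq_empty_iff.1 hfree hmem fun I => ?_
      rwa [Subsingleton.elim (boxCorner _ I) x]
    simp [hempty]
  | succ d ih =>
    have hslice : ∀ v ∈ Finset.range (k ^ 2 ^ d),
        2 ^ d * k * (lastSlice G v).card + 2 * (grid k d).card ≤
          2 * 2 ^ d * (grid k d).card + 2 ^ d * k * (boxesIn k (lastSlice G v)).card := by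
      intro v _
      obtain ⟨H, hHG, hH, hcard⟩ := exists_boxFree_subset k (lastSlice G v)
      have h1 := ih H (hHG.trans (lastSlice_subset_grid hG v)) hH
      have h2 := Nat.mul_le_mul_left (2 ^ d * k) hcard
      linarith
    have hsum := Finset.sum_le_sum hslice
    simp only [Finset.sum_add_distrib, ← Finset.mul_sum, Finset.sum_const, Finset.card_range,
      smul_eq_mul, ← card_eq_sum_card_lastSlice hG] at hsum
    have hboxes := Nat.mul_le_mul_left k ((Nat.mul_le_mul_left (2 ^ d)
      (sum_card_boxesIn_lastSlice_le hfree)).trans (two_pow_mul_card_gridBoxes_le k d))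
    rw [← mul_card_grid] at hsum hboxes
    rw [card_grid_succ, ← mul_card_grid, pow_succ]
    nlinarith [hsum, hboxes]

/-- The finite set of naturals encoding a point of the grid, one initial segment per side. -/
def gridSet {d : ℕ} (x : Fin d → ℕ) : Finset ℕ :=
  Finset.univ.biUnion fun i => (Finset.range (x i)).image (Nat.pair i)

theorem mem_gridSet {d : ℕ} {x : Fin d → ℕ} {n : ℕ} :
    n ∈ gridSet x ↔ ∃ i : Fin d, n.unpair.1 = i ∧ n.unpair.2 < x i := by
  simp only [gridSet, Finset.mem_biUnion, Finset.mem_univ, true_and, Finset.mem_image,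
    Finset.mem_range]
  refine exists_congr fun i => ⟨?_, ?_⟩
  · rintro ⟨j, hj, rfl⟩
    simpa using hj
  · rintro ⟨h1, h2⟩
    exact ⟨_, h2, by rw [← h1, Nat.pair_unpair]⟩

theorem pair_mem_gridSet {d : ℕ} {x : Fin d → ℕ} {i : Fin d} {j : ℕ} :
    Nat.pair i j ∈ gridSet x ↔ j < x i := by
  simp [mem_gridSet, ← Fin.ext_iff]

theorem gridSet_injective {d : ℕ} : Function.Injective (gridSet : (Fin d → ℕ) → Finset ℕ) := by
  intro x y h
  funext i
  refine eq_of_forall_lt_iff fun j => ?_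
  rw [← pair_mem_gridSet, h, pair_mem_gridSet]

theorem gridSet_sup {d : ℕ} (x y : Fin d → ℕ) : gridSet (x ⊔ y) = gridSet x ∪ gridSet y := by
  ext n
  simp only [Finset.mem_union, mem_gridSet, Pi.sup_apply, lt_sup_iff, ← exists_or, and_or_left]

theorem gridSet_inf {d : ℕ} (x y : Fin d → ℕ) : gridSet (x ⊓ y) = gridSet x ∩ gridSet y := by
  ext n
  simp only [Finset.mem_inter, mem_gridSet, Pi.inf_apply, lt_inf_iff]
  constructor
  · rintro ⟨i, h, hx, hy⟩
    exact ⟨⟨i, h, hx⟩, i, h, hy⟩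
  · rintro ⟨⟨i, h, hx⟩, j, h', hy⟩
    obtain rfl : i = j := Fin.ext (h.symm.trans h')
    exact ⟨i, h, hx, hy⟩

theorem boxCorner_union {d : ℕ} {p : Fin d → ℕ × ℕ} (hp : ∀ i, (p i).1 < (p i).2)
    (I J : Finset (Fin d)) : boxCorner p (I ∪ J) = boxCorner p I ⊔ boxCorner p J := by
  funext i
  by_cases h1 : i ∈ I <;> by_cases h2 : i ∈ J <;> simp [boxCorner, h1, h2, (hp i).le]

theorem boxCorner_inter {d : ℕ} {p : Fin d → ℕ × ℕ} (hp : ∀ i, (p i).1 < (p i).2)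
    (I J : Finset (Fin d)) : boxCorner p (I ∩ J) = boxCorner p I ⊓ boxCorner p J := by
  funext i
  by_cases h1 : i ∈ I <;> by_cases h2 : i ∈ J <;> simp [boxCorner, h1, h2, (hp i).le]

theorem boxCorner_injective {d : ℕ} {p : Fin d → ℕ × ℕ} (hp : ∀ i, (p i).1 < (p i).2) :
    Function.Injective (boxCorner p) := by
  intro I J h
  ext i
  have hi := congrFun h i
  by_cases h1 : i ∈ I <;> by_cases h2 : i ∈ J <;>
    simp_all [boxCorner, (hp i).ne, (hp i).ne']

theorem isBooleanAlgebraDim_image_boxCorner {d : ℕ} {p : Fin d → ℕ × ℕ}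
    (hp : ∀ i, (p i).1 < (p i).2) :
    IsBooleanAlgebraDim d (Finset.univ.image fun I => gridSet (boxCorner p I)) :=
  ⟨fun I => gridSet (boxCorner p I), gridSet_injective.comp (boxCorner_injective hp),
    fun I J => ⟨by simp only [boxCorner_union hp, gridSet_sup],
      by simp only [boxCorner_inter hp, gridSet_inf]⟩,
    rfl⟩

theorem bd_free_upper_bound_construction (d k : ℕ) (hd : 2 ≤ d) (hk : 2 ≤ k) :
    ∃ F : Finset (Finset ℕ), F.card = k ^ (2 ^ d - 1) ∧
      ∀ G ⊆ F, IsBdFree d G → G.card ≤ 2 * k ^ (2 ^ d - 2) := by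
  have hk0 : 0 < k := by omega
  refine ⟨(grid k d).image gridSet, ?_, fun G hG hfree => ?_⟩
  · rw [Finset.card_image_of_injective _ gridSet_injective, card_grid hk0]
  obtain ⟨H, hH, rfl⟩ := Finset.subset_image_iff.1 hG
  rw [Finset.card_image_of_injective _ gridSet_injective]
  have hbox : boxesIn k H = ∅ := by
    refine Finset.filter_eq_empty_iff.2 fun p hp hcorner => ?_
    refine hfree _ (Finset.image_subset_iff.2 fun I _ =>
      Finset.mem_image_of_mem _ (hcorner I)) (isBooleanAlgebraDim_image_boxCorner fun i => ?_)
    exact (Finset.mem_filter.1 (Fintype.mem_piFinset.1 hp i)).2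
  have hle := card_boxFree_le k d H (by exact_mod_cast hH) hbox
  have hexp : 2 ^ d - 1 = (2 ^ d - 2) + 1 := by
    have := Nat.pow_le_pow_right two_pos hd
    omega
  rw [card_grid hk0, hexp, pow_succ] at hle
  have hpos : 0 < 2 ^ d * k := by positivity
  refine Nat.le_of_mul_le_mul_left ?_ hpos
  generalize k ^ (2 ^ d - 2) = m at hle ⊢
  linarith [Nat.zero_le (m * k)]
end

section
/- For every integer k ≥ 2 there exists a family F of k^3 distinct finite sets such that every B_2-free subfamily of F has size at most (3/2) · k^2. -/
open Finset in
/-- The product of two chains of finite sets, one on the even and one on the odd numbers. -/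
def chainProduct (p : ℕ × ℕ) : Finset ℕ :=
  (range p.1).image (fun t => 2 * t) ∪ (range p.2).image (fun t => 2 * t + 1)

theorem mem_chainProduct {p : ℕ × ℕ} {n : ℕ} :
    n ∈ chainProduct p ↔ (n % 2 = 0 ∧ n / 2 < p.1) ∨ (n % 2 = 1 ∧ n / 2 < p.2) := by
  simp only [chainProduct, Finset.mem_union, Finset.mem_image, Finset.mem_range]
  constructor
  · rintro (⟨t, ht, rfl⟩ | ⟨t, ht, rfl⟩) <;> omega
  · rintro (⟨h, ht⟩ | ⟨h, ht⟩)
    · exact Or.inl ⟨n / 2, ht, by omega⟩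
    · exact Or.inr ⟨n / 2, ht, by omega⟩

theorem chainProduct_union (p q : ℕ × ℕ) :
    chainProduct p ∪ chainProduct q = chainProduct (p ⊔ q) := by
  ext n
  simp only [Finset.mem_union, mem_chainProduct, Prod.fst_sup, Prod.snd_sup, lt_sup_iff]
  tauto

theorem chainProduct_inter (p q : ℕ × ℕ) :
    chainProduct p ∩ chainProduct q = chainProduct (p ⊓ q) := by
  ext n
  simp only [Finset.mem_inter, mem_chainProduct, Prod.fst_inf, Prod.snd_inf, lt_inf_iff]
  omega

theorem chainProduct_injective : Function.Injective chainProduct := by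
  intro p q h
  have key (n : ℕ) := (Finset.ext_iff.mp h) n
  simp only [mem_chainProduct] at key
  have h1 := key (2 * p.1)
  have h2 := key (2 * q.1)
  have h3 := key (2 * p.2 + 1)
  have h4 := key (2 * q.2 + 1)
  ext <;> omega

/-- A nondegenerate rectangle in a product of two chains is a Boolean algebra of dimension 2. -/
theorem isBooleanAlgebraDim_two_rectangle {a b c d : ℕ} (hab : a < b) (hcd : c < d) :
    IsBooleanAlgebraDim 2 (({a, b} ×ˢ {c, d} : Finset (ℕ × ℕ)).image chainProduct) := by
  refine ⟨fun I => chainProduct (if 0 ∈ I then b else a, if 1 ∈ I then d else c),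
    ?_, fun I J => ⟨?_, ?_⟩, ?_⟩
  · intro I J h
    obtain ⟨h₀, h₁⟩ := Prod.mk.inj (chainProduct_injective h)
    have aux {p q : Prop} [Decidable p] [Decidable q] {u v : ℕ} (huv : u < v)
        (h : (if p then v else u) = if q then v else u) : p ↔ q := by
      split_ifs at h <;> first | omega | tauto
    ext x
    fin_cases x
    · exact aux hab h₀
    · exact aux hcd h₁
  · rw [chainProduct_union]
    refine congrArg chainProduct (Prod.ext ?_ ?_) <;>
      simp only [Finset.mem_union, Prod.fst_sup, Prod.snd_sup] <;> split_ifs <;>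
      first | omega | tauto
  · rw [chainProduct_inter]
    refine congrArg chainProduct (Prod.ext ?_ ?_) <;>
      simp only [Finset.mem_inter, Prod.fst_inf, Prod.snd_inf] <;> split_ifs <;>
      first | omega | tauto
  · ext s
    simp only [Finset.mem_image, Finset.mem_product, Finset.mem_insert, Finset.mem_singleton,
      Finset.mem_univ, true_and, Prod.exists]
    constructor
    · rintro ⟨x, y, ⟨rfl | rfl, rfl | rfl⟩, rfl⟩
      · exact ⟨∅, by simp⟩
      · exact ⟨{1}, by simp⟩
      · exact ⟨{0}, by simp⟩
      · exact ⟨{0, 1}, by simp⟩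
    · rintro ⟨I, rfl⟩
      exact ⟨_, _, ⟨by split_ifs <;> simp, by split_ifs <;> simp⟩, rfl⟩

theorem Nat.le_one_add_choose_two (n : ℕ) : n ≤ 1 + n.choose 2 := by
  induction n with
  | zero => simp
  | succ n ih =>
    rw [Nat.choose_succ_succ' n 1, Nat.choose_one_right]
    rcases n.eq_zero_or_pos with rfl | hn
    · simp
    · omega

/-- A subset of the `k × m` grid that contains no rectangle has at most `m + k.choose 2` points. -/
theorem card_le_of_rectangle_free {k m : ℕ} {S : Finset (ℕ × ℕ)}
    (hS : S ⊆ Finset.range k ×ˢ Finset.range m)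
    (hfree : ∀ a b c d, a < b → c < d → ¬ ({a, b} ×ˢ {c, d} : Finset (ℕ × ℕ)) ⊆ S) :
    S.card ≤ m + k.choose 2 := by
  let col (j : ℕ) : Finset ℕ := (Finset.range k).filter fun i => (i, j) ∈ S
  have hcard : S.card = ∑ j ∈ Finset.range m, (col j).card := by
    rw [Finset.card_eq_sum_card_fiberwise (f := Prod.snd) (t := Finset.range m)
      fun p hp => (Finset.mem_product.mp (hS hp)).2]
    refine Finset.sum_congr rfl fun j _ => ?_
    refine Finset.card_nbij' Prod.fst (fun i => (i, j)) ?_ ?_ ?_ ?_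
    · rintro ⟨x, y⟩ hp
      obtain ⟨hxy, rfl⟩ : (x, y) ∈ S ∧ y = j := by simpa using hp
      have := hS hxy
      simp_all [col]
    · intro i hi
      simp_all [col]
    · rintro ⟨x, y⟩ hp
      simp_all
    · intro i _
      rfl
  have hdisj : ((Finset.range m : Finset ℕ) : Set ℕ).PairwiseDisjoint
      fun j => (col j).powersetCard 2 := by
    have aux : ∀ c d, c < d → Disjoint ((col c).powersetCard 2) ((col d).powersetCard 2) := by
      intro c d hcd
      rw [Finset.disjoint_left]
      intro P hc hd
      rw [Finset.mem_powersetCard] at hc hd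
      obtain ⟨x, y, hxy, rfl⟩ := Finset.card_eq_two.mp hc.2
      have hmem : ∀ u ∈ ({x, y} : Finset ℕ), ∀ v ∈ ({c, d} : Finset ℕ), (u, v) ∈ S := by
        intro u hu v hv
        rcases Finset.mem_insert.mp hv with rfl | hv
        · exact (Finset.mem_filter.mp (hc.1 hu)).2
        · rw [Finset.mem_singleton.mp hv]
          exact (Finset.mem_filter.mp (hd.1 hu)).2
      have hsub : ({x, y} ×ˢ {c, d} : Finset (ℕ × ℕ)) ⊆ S := fun p hp =>
        hmem p.1 (Finset.mem_product.mp hp).1 p.2 (Finset.mem_product.mp hp).2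
      rcases hxy.lt_or_gt with h | h
      · exact hfree x y c d h hcd hsub
      · exact hfree y x c d h hcd (by rwa [Finset.pair_comm])
    intro c _ d _ hne
    rcases hne.lt_or_gt with h | h
    · exact aux c d h
    · exact (aux d c h).symm
  have hpairs : ∑ j ∈ Finset.range m, (col j).card.choose 2 ≤ k.choose 2 := by
    calc ∑ j ∈ Finset.range m, (col j).card.choose 2
        = ((Finset.range m).biUnion fun j => (col j).powersetCard 2).card := by
          rw [Finset.card_biUnion hdisj]
          simp only [Finset.card_powersetCard]
      _ ≤ ((Finset.range k).powersetCard 2).card :=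
          Finset.card_le_card <| Finset.biUnion_subset.mpr fun j _ =>
            Finset.powersetCard_mono (Finset.filter_subset _ _)
      _ = k.choose 2 := by simp
  calc S.card = ∑ j ∈ Finset.range m, (col j).card := hcard
    _ ≤ ∑ j ∈ Finset.range m, (1 + (col j).card.choose 2) :=
        Finset.sum_le_sum fun j _ => Nat.le_one_add_choose_two _
    _ = m + ∑ j ∈ Finset.range m, (col j).card.choose 2 := by simp [Finset.sum_add_distrib]
    _ ≤ m + k.choose 2 := by omega

theorem b2_free_upper_bound_construction (k : ℕ) (hk : 2 ≤ k) :
    ∃ F : Finset (Finset ℕ), F.card = k ^ 3 ∧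
      ∀ G ⊆ F, IsBdFree 2 G → (G.card : ℝ) ≤ (3 / 2 : ℝ) * (k : ℝ) ^ 2 := by
  refine ⟨(Finset.range k ×ˢ Finset.range (k ^ 2)).image chainProduct, ?_, ?_⟩
  · rw [Finset.card_image_of_injective _ chainProduct_injective]
    simp only [Finset.card_product, Finset.card_range]
    ring
  · intro G hG hfree
    obtain ⟨S, hS, rfl⟩ := Finset.subset_image_iff.mp hG
    have hle := card_le_of_rectangle_free (k := k) (m := k ^ 2) (S := S) (by exact_mod_cast hS)
      fun a b c d hab hcd hsub =>
        hfree _ (Finset.image_subset_image hsub) (isBooleanAlgebraDim_two_rectangle hab hcd)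
    rw [Finset.card_image_of_injective _ chainProduct_injective]
    have hle' : (S.card : ℝ) ≤ (k : ℝ) ^ 2 + (k.choose 2 : ℕ) := by exact_mod_cast hle
    rw [Nat.cast_choose_two] at hle'
    have : (0 : ℝ) ≤ k := k.cast_nonneg
    linarith
end

section
/- Let d ≥ 2 and suppose the family B of 2^d distinct sets forms a Boolean algebra of dimension d. Then there exists a subfamily C ⊆ B with |C| = ⌈log₂(d+2)⌉ that determines B. -/
/-- A subfamily `C` determines `B` if every member of `B` belongs to the smallest
family of sets containing `C` that is closed under pairwise unions, pairwise
intersections, and set differences. -/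
def Determines {α : Type*} [DecidableEq α] (C B : Finset (Finset α)) : Prop :=
  ∀ S ∈ B, ∀ D : Set (Finset α), ↑C ⊆ D →
    (∀ X ∈ D, ∀ Y ∈ D, X ∪ Y ∈ D ∧ X ∩ Y ∈ D ∧ X \ Y ∈ D) → S ∈ D

theorem add_two_le_two_pow {d : ℕ} (hd : 2 ≤ d) : d + 2 ≤ 2 ^ d := by
  induction d, hd using Nat.le_induction with
  | base => norm_num
  | succ n hn ih => rw [pow_succ]; omega

theorem exists_injective_finset_ne_empty_ne_univ {d k : ℕ} (h : d + 2 ≤ 2 ^ k) :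
    ∃ p : Fin d → Finset (Fin k), Function.Injective p ∧
      ∀ i, p i ≠ ∅ ∧ p i ≠ Finset.univ := by
  let S : Finset (Finset (Fin k)) := (Finset.univ.erase ∅).erase Finset.univ
  have hS : d ≤ S.card := by
    have h₁ := Finset.pred_card_le_card_erase (s := (Finset.univ : Finset (Finset (Fin k))))
      (a := ∅)
    have h₂ := Finset.pred_card_le_card_erase
      (s := (Finset.univ : Finset (Finset (Fin k))).erase ∅) (a := Finset.univ)
    have h₃ : (Finset.univ : Finset (Finset (Fin k))).card = 2 ^ k := by simp
    change d ≤ ((Finset.univ.erase ∅).erase Finset.univ).card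
    omega
  obtain ⟨e⟩ := Function.Embedding.nonempty_of_card_le (α := Fin d) (β := S) (by simpa using hS)
  refine ⟨fun i => (e i).1, fun i j hij => e.injective (Subtype.ext hij), fun i => ?_⟩
  have hi := (e i).2
  simp only [S, Finset.mem_erase] at hi
  exact ⟨hi.2.1, hi.1⟩

/-- The coordinate sets of an injective family of nonempty proper subsets of `Fin k` generate
every subset of the index set. -/
theorem mem_of_separating_coordinates {d k : ℕ} (hk : 0 < k) (p : Fin d → Finset (Fin k))
    (hinj : Function.Injective p) (hp : ∀ i, p i ≠ ∅ ∧ p i ≠ Finset.univ)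
    (E : Set (Finset (Fin d))) (hE : ∀ j, Finset.univ.filter (fun i => j ∈ p i) ∈ E)
    (hunion : ∀ I ∈ E, ∀ J ∈ E, I ∪ J ∈ E) (hinter : ∀ I ∈ E, ∀ J ∈ E, I ∩ J ∈ E)
    (hsdiff : ∅ ∈ E → ∀ I ∈ E, ∀ J ∈ E, I \ J ∈ E) (I : Finset (Fin d)) : I ∈ E := by
  let c : Fin k → Finset (Fin d) := fun j => Finset.univ.filter (fun i => j ∈ p i)
  have hempty : ∅ ∈ E := by
    have hne : (Finset.univ : Finset (Fin k)).Nonempty := ⟨⟨0, hk⟩, Finset.mem_univ _⟩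
    have hmem : Finset.univ.inf' hne c ∈ E :=
      Finset.inf'_induction (p := (· ∈ E)) hne c hinter fun j _ => hE j
    convert hmem
    refine (Finset.eq_empty_of_forall_notMem fun i hi => (hp i).2 ?_).symm
    refine Finset.eq_univ_of_forall fun j => ?_
    have hle : Finset.univ.inf' hne c ≤ c j := Finset.inf'_le c (Finset.mem_univ j)
    simpa [c] using hle hi
  have huniv : Finset.univ ∈ E := by
    have hmem : Finset.univ.sup c ∈ E :=
      Finset.sup_induction (p := (· ∈ E)) hempty hunion fun j _ => hE j
    convert hmem
    refine (Finset.eq_univ_of_forall fun i => ?_).symm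
    obtain ⟨j, hj⟩ := Finset.nonempty_iff_ne_empty.mpr (hp i).1
    exact Finset.mem_sup.mpr ⟨j, Finset.mem_univ j, by simpa [c] using hj⟩
  have hsingleton (i : Fin d) : {i} ∈ E := by
    let g : Fin k → Finset (Fin d) := fun j => if j ∈ p i then c j else Finset.univ \ c j
    have hmem : Finset.univ.inf g ∈ E := by
      refine Finset.inf_induction (p := (· ∈ E)) huniv hinter fun j _ => ?_
      by_cases hj : j ∈ p i
      · simpa only [g, if_pos hj] using hE j
      · simpa only [g, if_neg hj] using hsdiff hempty _ huniv _ (hE j)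
    convert hmem
    ext i'
    have hg (j : Fin k) : i' ∈ g j ↔ (j ∈ p i' ↔ j ∈ p i) := by
      by_cases hj : j ∈ p i <;> simp [g, c, hj]
    simp only [Finset.mem_singleton, Finset.mem_inf, Finset.mem_univ, true_imp_iff, hg]
    exact ⟨fun h => by simp [h], fun h => hinj (Finset.ext h)⟩
  induction I using Finset.induction_on with
  | empty => exact hempty
  | insert i I _ ih => exact hunion _ (hsingleton i) _ ih

theorem Finset.map_sdiff_eq_sdiff_union_of_lattice {ι α : Type*} [DecidableEq ι] [DecidableEq α]
    (f : Finset ι → Finset α)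
    (hf : ∀ I J : Finset ι, f (I ∪ J) = f I ∪ f J ∧ f (I ∩ J) = f I ∩ f J) (I J : Finset ι) :
    f (I \ J) = (f I \ f J) ∪ f ∅ := by
  have h₁ := (hf (I \ J) (I ∩ J)).1
  have h₂ := (hf (I \ J) J).2
  have h₃ := (hf (I \ J) ∅).1
  have h₄ := (hf I J).2
  rw [Finset.sdiff_union_inter] at h₁
  rw [Finset.sdiff_inter_self] at h₂
  rw [Finset.union_empty] at h₃
  ext x
  have e₁ := Finset.ext_iff.mp h₁ x
  have e₂ := Finset.ext_iff.mp h₂ x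
  have e₃ := Finset.ext_iff.mp h₃ x
  have e₄ := Finset.ext_iff.mp h₄ x
  simp only [Finset.mem_union, Finset.mem_inter, Finset.mem_sdiff] at *
  tauto

theorem Determines.mono {α : Type*} [DecidableEq α] {C C' B : Finset (Finset α)}
    (h : Determines C B) (hC : C ⊆ C') : Determines C' B :=
  fun S hS D hD hclosed => h S hS D ((Finset.coe_subset.mpr hC).trans hD) hclosed

theorem small_determining_subfamily_exists {α : Type*} [DecidableEq α]
    (d : ℕ) (hd : 2 ≤ d) (B : Finset (Finset α)) (hB : IsBooleanAlgebraDim d B) :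
    ∃ C ⊆ B, C.card = Nat.clog 2 (d + 2) ∧ Determines C B := by
  obtain ⟨f, hinj, hf, rfl⟩ := hB
  set k := Nat.clog 2 (d + 2)
  have hkpos : 0 < k := Nat.clog_pos one_lt_two (by omega)
  obtain ⟨p, hpinj, hp⟩ :=
    exists_injective_finset_ne_empty_ne_univ (Nat.le_pow_clog one_lt_two (d + 2))
  let C : Finset (Finset α) :=
    Finset.univ.image fun j : Fin k => f (Finset.univ.filter fun i => j ∈ p i)
  have hCB : C ⊆ Finset.image f Finset.univ := by
    intro X hX
    obtain ⟨j, -, rfl⟩ := Finset.mem_image.mp hX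
    exact Finset.mem_image_of_mem f (Finset.mem_univ _)
  have hCcard : C.card ≤ k := by
    simpa using Finset.card_image_le (s := Finset.univ)
      (f := fun j : Fin k => f (Finset.univ.filter fun i => j ∈ p i))
  have hBcard : k ≤ (Finset.image f Finset.univ).card := by
    rw [Finset.card_image_of_injective _ hinj, Finset.card_univ, Fintype.card_finset,
      Fintype.card_fin]
    exact (Nat.clog_le_of_le_pow (add_two_le_two_pow hd)).trans Nat.lt_two_pow_self.le
  have hdet : Determines C (Finset.image f Finset.univ) := by
    intro S hS D hD hclosed
    obtain ⟨I, -, rfl⟩ := Finset.mem_image.mp hS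
    refine mem_of_separating_coordinates hkpos p hpinj hp {I | f I ∈ D} (fun j => ?_)
      (fun I hI J hJ => ?_) (fun I hI J hJ => ?_) (fun h₀ I hI J hJ => ?_) I
    · exact hD (Finset.mem_coe.mpr (Finset.mem_image_of_mem _ (Finset.mem_univ j)))
    · simpa only [Set.mem_ofPred_eq, (hf I J).1] using (hclosed _ hI _ hJ).1
    · simpa only [Set.mem_ofPred_eq, (hf I J).2] using (hclosed _ hI _ hJ).2.1
    · rw [Set.mem_ofPred_eq, Finset.map_sdiff_eq_sdiff_union_of_lattice f hf]
      exact (hclosed _ (hclosed _ hI _ hJ).2.2 _ h₀).1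
  obtain ⟨C', hCC', hC'B, hC'card⟩ :=
    Finset.exists_subsuperset_card_eq hCB hCcard hBcard
  exact ⟨C', hC'B, hC'card, hdet.mono hCC'⟩
end

section
/- For every integer d ≥ 2, every family F of m distinct finite sets contains at most C(m, ⌈log₂(d+2)⌉) subfamilies that form a Boolean algebra of dimension d, where C(m,k) denotes the binomial coefficient. -/
/-- `Y` contains the intersection of the members of `S`, is contained in their union, and is a
union of cells of their Venn diagram. -/
def IsUnionOfCells {α : Type*} (S : Finset (Finset α)) (Y : Finset α) : Prop :=
  (∀ x, (∀ s ∈ S, x ∈ s) → x ∈ Y) ∧ (∀ x ∈ Y, ∃ s ∈ S, x ∈ s) ∧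
    ∀ x y, (∀ s ∈ S, x ∈ s ↔ y ∈ s) → x ∈ Y → y ∈ Y

/-- There are distinct proper nonempty codes for `d` letters as soon as `d + 2 ≤ 2 ^ k`. -/
theorem exists_proper_code (d k : ℕ) (h : d + 2 ≤ 2 ^ k) :
    ∃ c : Fin d → Finset (Fin k), Function.Injective c ∧ ∀ a, c a ≠ ∅ ∧ c a ≠ Finset.univ := by
  have hcard : Fintype.card (Fin d) ≤
      (((Finset.univ : Finset (Finset (Fin k))).erase ∅).erase Finset.univ).card := by
    have h1 := Finset.pred_card_le_card_erase
      (s := (Finset.univ : Finset (Finset (Fin k)))) (a := ∅)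
    have h2 := Finset.pred_card_le_card_erase
      (s := (Finset.univ : Finset (Finset (Fin k))).erase ∅) (a := Finset.univ)
    have h3 : (Finset.univ : Finset (Finset (Fin k))).card = 2 ^ k := by simp
    rw [Fintype.card_fin]
    omega
  rw [← Fintype.card_coe] at hcard
  obtain ⟨e⟩ := Function.Embedding.nonempty_of_card_le hcard
  refine ⟨fun a => (e a).1, fun a b hab => e.injective (Subtype.ext hab), fun a => ?_⟩
  have := (e a).2
  simp only [Finset.mem_erase] at this
  exact ⟨this.2.1, this.1⟩

/-- If there are more than `2 ^ (k - 1)` codes, counting the two trivial ones, then they separate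
the coordinates. -/
theorem code_separates {d k : ℕ} (hk : 2 ^ (k - 1) < d + 2) {c : Fin d → Finset (Fin k)}
    (hc : Function.Injective c) (hp : ∀ a, c a ≠ ∅ ∧ c a ≠ Finset.univ) {i j : Fin k}
    (hij : ∀ a, i ∈ c a ↔ j ∈ c a) : i = j := by
  by_contra hne
  set C : Finset (Finset (Fin k)) := insert ∅ (insert Finset.univ (Finset.univ.image c)) with hC
  have hCcard : C.card = d + 2 := by
    rw [hC, Finset.card_insert_of_notMem, Finset.card_insert_of_notMem,
      Finset.card_image_of_injective _ hc, Finset.card_fin]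
    · simp [hp]
    · simp only [Finset.mem_insert, Finset.mem_image, Finset.mem_univ, true_and, not_or,
        not_exists]
      exact ⟨fun h => Finset.notMem_empty i (h ▸ Finset.mem_univ i), fun a => (hp a).1⟩
  have hCij : ∀ s ∈ C, i ∈ s ↔ j ∈ s := by
    intro s hs
    simp only [hC, Finset.mem_insert, Finset.mem_image, Finset.mem_univ, true_and] at hs
    rcases hs with rfl | rfl | ⟨a, rfl⟩
    · simp
    · simp
    · exact hij a
  have hle : C.card ≤ ((Finset.univ : Finset (Fin k)).erase i).powerset.card := by
    refine Finset.card_le_card_of_injOn (fun s => s.erase i) ?_ ?_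
    · intro s _
      simp
    · intro s hs t ht hst
      have key : ∀ x, x ≠ i → (x ∈ s ↔ x ∈ t) := fun x hx => by
        have := congrArg (x ∈ ·) hst
        simpa [hx] using this
      ext x
      by_cases hx : x = i
      · rw [hx, hCij s hs, hCij t ht, key j (Ne.symm hne)]
      · exact key x hx
  rw [Finset.card_powerset, Finset.card_erase_of_mem (Finset.mem_univ i), Finset.card_fin] at hle
  omega

section LatticeMap

variable {α ι : Type*} [DecidableEq α] [DecidableEq ι] {f : Finset ι → Finset α}

theorem monotone_of_map_union (hf : ∀ I J, f (I ∪ J) = f I ∪ f J) : Monotone f := by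
  intro I J hIJ
  rw [← Finset.union_eq_right.2 hIJ, hf]
  exact Finset.subset_union_left

theorem mem_map_iff_of_map_union (hf : ∀ I J, f (I ∪ J) = f I ∪ f J) (I : Finset ι) (x : α) :
    x ∈ f I ↔ x ∈ f ∅ ∨ ∃ a ∈ I, x ∈ f {a} := by
  induction I using Finset.induction_on with
  | empty => simp
  | insert a I _ ih =>
    rw [Finset.insert_eq, hf, Finset.mem_union, ih]
    simp only [Finset.mem_union, Finset.mem_singleton, or_and_right, exists_or,
      exists_eq_left]
    tauto

/-- A point lies in all values of a lattice map, or in none, or in those at sets containing a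
given index. -/
theorem mem_map_trichotomy (hf : ∀ I J, f (I ∪ J) = f I ∪ f J ∧ f (I ∩ J) = f I ∩ f J) (x : α) :
    (∀ I, x ∈ f I) ∨ (∀ I, x ∉ f I) ∨ ∃ a, ∀ I, x ∈ f I ↔ a ∈ I := by
  have hu := fun I J => (hf I J).1
  by_cases h0 : x ∈ f ∅
  · exact Or.inl fun I => monotone_of_map_union hu (Finset.empty_subset I) h0
  by_cases h1 : ∃ a, x ∈ f {a}
  · obtain ⟨a, ha⟩ := h1
    refine Or.inr (Or.inr ⟨a, fun I => ⟨fun hI => ?_, fun hI => ?_⟩⟩)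
    · by_contra haI
      apply h0
      rw [← Finset.inter_singleton_of_notMem haI, (hf _ _).2]
      exact Finset.mem_inter.2 ⟨hI, ha⟩
    · exact monotone_of_map_union hu (Finset.singleton_subset_iff.2 hI) ha
  · refine Or.inr (Or.inl fun I hI => ?_)
    rcases (mem_map_iff_of_map_union hu I x).1 hI with h | ⟨a, _, h⟩
    · exact h0 h
    · exact h1 ⟨a, h⟩

end LatticeMap

/-- The range of a lattice map consists of the unions of cells of the sets attached to the
coordinates of a proper code. -/
theorem mem_range_iff_isUnionOfCells {α ι κ : Type*} [DecidableEq α] [Fintype ι] [DecidableEq ι]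
    [Fintype κ] [DecidableEq κ] [Nonempty κ] {f : Finset ι → Finset α}
    (hf : ∀ I J, f (I ∪ J) = f I ∪ f J ∧ f (I ∩ J) = f I ∩ f J) {c : ι → Finset κ}
    (hc : Function.Injective c) (hp : ∀ a, c a ≠ ∅ ∧ c a ≠ Finset.univ) (Y : Finset α) :
    (∃ I, f I = Y) ↔
      IsUnionOfCells (Finset.univ.image fun i => f {a | i ∈ c a}) Y := by
  classical
  have hin : ∀ a, ∃ i, i ∈ c a := fun a => Finset.nonempty_iff_ne_empty.2 (hp a).1
  have hout : ∀ a, ∃ i, i ∉ c a := fun a => by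
    by_contra! h
    exact (hp a).2 (Finset.eq_univ_iff_forall.2 h)
  obtain ⟨i₀⟩ := ‹Nonempty κ›
  simp only [IsUnionOfCells, Finset.mem_image, Finset.mem_univ, true_and, forall_exists_index,
    forall_apply_eq_imp_iff, exists_exists_eq_and]
  constructor
  · rintro ⟨I, rfl⟩
    refine ⟨fun x hx => ?_, fun x hx => ?_, fun x y hxy hx => ?_⟩
    · rcases mem_map_trichotomy hf x with h | h | ⟨a, h⟩
      · exact h I
      · exact absurd (hx i₀) (h _)
      · obtain ⟨i, hi⟩ := hout a
        exact absurd ((h _).1 (hx i)) (by simpa using hi)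
    · rcases mem_map_trichotomy hf x with h | h | ⟨a, h⟩
      · exact ⟨i₀, h _⟩
      · exact absurd hx (h I)
      · obtain ⟨i, hi⟩ := hin a
        exact ⟨i, (h _).2 (by simpa using hi)⟩
    · rcases mem_map_trichotomy hf y with h' | h' | ⟨b, h'⟩
      · exact h' I
      · rcases mem_map_trichotomy hf x with h | h | ⟨a, h⟩
        · exact absurd ((hxy i₀).1 (h _)) (h' _)
        · exact absurd hx (h I)
        · obtain ⟨i, hi⟩ := hin a
          exact absurd ((hxy i).1 ((h _).2 (by simpa using hi))) (h' _)
      · rcases mem_map_trichotomy hf x with h | h | ⟨a, h⟩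
        · obtain ⟨i, hi⟩ := hout b
          exact absurd ((h' _).1 ((hxy i).1 (h _))) (by simpa using hi)
        · exact absurd hx (h I)
        · have hab : a = b := hc <| by
            ext i
            have := hxy i
            rw [h, h'] at this
            simpa using this
          rw [h', ← hab, ← h]
          exact hx
  · rintro ⟨hall, hsome, hcell⟩
    refine ⟨({a | ∃ y ∈ Y, ∀ I, y ∈ f I ↔ a ∈ I} : Finset ι), ?_⟩
    ext x
    rcases mem_map_trichotomy hf x with h | h | ⟨a, h⟩
    · exact iff_of_true (h _) (hall x fun i => h _)
    · refine iff_of_false (h _) fun hx => ?_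
      obtain ⟨i, hi⟩ := hsome x hx
      exact h _ hi
    · rw [h, Finset.mem_filter]
      refine ⟨?_, fun hx => ⟨Finset.mem_univ a, x, hx, h⟩⟩
      rintro ⟨-, y, hy, hya⟩
      exact hcell y x (fun i => by rw [h, hya]) hy

theorem IsBooleanAlgebraDim.exists_generators {α : Type*} [DecidableEq α] {d : ℕ}
    {B : Finset (Finset α)} (hB : IsBooleanAlgebraDim d B) :
    ∃ S ⊆ B, S.card = Nat.clog 2 (d + 2) ∧ ∀ Y, Y ∈ B ↔ IsUnionOfCells S Y := by
  obtain ⟨f, hinj, hf, rfl⟩ := hB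
  set k := Nat.clog 2 (d + 2) with hk
  have hkpos : 0 < k := Nat.clog_pos one_lt_two (by omega)
  have : Nonempty (Fin k) := ⟨⟨0, hkpos⟩⟩
  obtain ⟨c, hc, hp⟩ := exists_proper_code d k (Nat.le_pow_clog one_lt_two _)
  refine ⟨Finset.univ.image fun i => f {a | i ∈ c a}, ?_, ?_, fun Y => ?_⟩
  · intro Y hY
    obtain ⟨i, -, rfl⟩ := Finset.mem_image.1 hY
    exact Finset.mem_image_of_mem f (Finset.mem_univ _)
  · rw [Finset.card_image_of_injective, Finset.card_fin]
    intro i j hij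
    refine code_separates (Nat.pow_pred_clog_lt_self one_lt_two (by omega)) hc hp fun a => ?_
    have h := Finset.ext_iff.1 (hinj hij) a
    simp only [Finset.mem_filter, Finset.mem_univ, true_and] at h
    exact h
  · rw [← mem_range_iff_isUnionOfCells hf hc hp]
    simp

theorem count_boolean_subalgebras {α : Type*} [DecidableEq α]
    (d : ℕ) (hd : 2 ≤ d) (m : ℕ) (F : Finset (Finset α)) (hF : F.card = m) :
    {B : Finset (Finset α) | B ⊆ F ∧ IsBooleanAlgebraDim d B}.ncard
      ≤ m.choose (Nat.clog 2 (d + 2)) := by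
  have hgen : ∀ B : Finset (Finset α), ∃ S, IsBooleanAlgebraDim d B →
      S ⊆ B ∧ S.card = Nat.clog 2 (d + 2) ∧ ∀ Y, Y ∈ B ↔ IsUnionOfCells S Y := fun B => by
    by_cases hB : IsBooleanAlgebraDim d B
    · obtain ⟨S, hS⟩ := hB.exists_generators
      exact ⟨S, fun _ => hS⟩
    · exact ⟨∅, fun h => absurd h hB⟩
  choose g hg using hgen
  rw [← hF, ← Finset.card_powersetCard, ← Set.ncard_coe_finset]
  refine Set.ncard_le_ncard_of_injOn g ?_ ?_ (Finset.finite_toSet _)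
  · rintro B ⟨hBF, hB⟩
    obtain ⟨hsub, hcard, -⟩ := hg B hB
    exact Finset.mem_coe.2 (Finset.mem_powersetCard.2 ⟨hsub.trans hBF, hcard⟩)
  · rintro B ⟨-, hB⟩ B' ⟨-, hB'⟩ h
    ext Y
    rw [(hg B hB).2.2, (hg B' hB').2.2, h]
end

section
/- Let k ≥ 2 and let H be a bipartite graph with parts X of size k and Y of size k², all of whose edges join X to Y. If H contains no complete bipartite subgraph K_{2,2} (i.e., there are no two vertices in X and two vertices in Y that are pairwise joined), then H has at most C(k,2) + k² edges, where C(k,2) is the binomial coefficient. -/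
/-- If any two members of a finite family of subsets of `α` share at most one element, then their
sets of pairs are disjoint, so there are at most `(card α).choose 2` pairs in total. -/
theorem sum_choose_two_le_of_card_inter_le_one {α β : Type*} [Fintype α] [Fintype β]
    [DecidableEq α] (N : β → Finset α)
    (hN : ∀ y₁ y₂, y₁ ≠ y₂ → (N y₁ ∩ N y₂).card ≤ 1) :
    ∑ y, (N y).card.choose 2 ≤ (Fintype.card α).choose 2 := by
  have hdisj : ((Finset.univ : Finset β) : Set β).PairwiseDisjoint
      fun y => (N y).powersetCard 2 := by
    intro y₁ _ y₂ _ hne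
    refine Finset.disjoint_left.2 fun s hs₁ hs₂ => ?_
    rw [Finset.mem_powersetCard] at hs₁ hs₂
    have h := Finset.card_le_card (Finset.subset_inter hs₁.1 hs₂.1)
    have := hN y₁ y₂ hne
    omega
  calc ∑ y, (N y).card.choose 2
      = (Finset.univ.biUnion fun y => (N y).powersetCard 2).card := by
        simp [Finset.card_biUnion hdisj]
    _ ≤ ((Finset.univ : Finset α).powersetCard 2).card :=
        Finset.card_le_card <| Finset.biUnion_subset.2 fun y _ =>
          Finset.powersetCard_mono (Finset.subset_univ _)
    _ = (Fintype.card α).choose 2 := by simp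

theorem le_choose_two_add_one (n : ℕ) : n ≤ n.choose 2 + 1 := by
  induction n with
  | zero => simp
  | succ n ih =>
    rw [Nat.choose_succ_succ' n 1, Nat.choose_one_right]
    rcases n with _ | n <;> omega

theorem k22_free_bipartite_bound (k : ℕ) (hk : 2 ≤ k)
    (E : Finset (Fin k × Fin (k ^ 2)))
    (hE : ¬ ∃ (x₁ x₂ : Fin k) (y₁ y₂ : Fin (k ^ 2)), x₁ ≠ x₂ ∧ y₁ ≠ y₂ ∧
      (x₁, y₁) ∈ E ∧ (x₁, y₂) ∈ E ∧ (x₂, y₁) ∈ E ∧ (x₂, y₂) ∈ E) :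
    E.card ≤ k.choose 2 + k ^ 2 := by
  let N : Fin (k ^ 2) → Finset (Fin k) := fun y => {x | (x, y) ∈ E}
  have hN : ∀ y₁ y₂, y₁ ≠ y₂ → (N y₁ ∩ N y₂).card ≤ 1 := by
    intro y₁ y₂ hne
    refine Finset.card_le_one.2 fun x₁ h₁ x₂ h₂ => ?_
    simp only [N, Finset.mem_inter, Finset.mem_filter, Finset.mem_univ, true_and] at h₁ h₂
    by_contra hx
    exact hE ⟨x₁, x₂, y₁, y₂, hx, hne, h₁.1, h₁.2, h₂.1, h₂.2⟩
  have hcard : E.card = ∑ y, (N y).card := by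
    rw [Finset.card_eq_sum_card_fiberwise (f := Prod.snd) (t := Finset.univ) (by simp)]
    refine Finset.sum_congr rfl fun y _ => ?_
    refine Finset.card_nbij' Prod.fst (fun x => (x, y)) ?_ ?_ ?_ ?_
    · rintro ⟨x, z⟩ h
      obtain ⟨h, rfl⟩ := Finset.mem_filter.1 h
      simpa [N] using h
    · intro x h
      simpa [N] using h
    · rintro ⟨x, z⟩ h
      obtain ⟨-, rfl⟩ := Finset.mem_filter.1 h
      rfl
    · intro x _
      rfl
  calc E.card = ∑ y, (N y).card := hcard
    _ ≤ ∑ y, ((N y).card.choose 2 + 1) := Finset.sum_le_sum fun y _ => le_choose_two_add_one _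
    _ = ∑ y, (N y).card.choose 2 + k ^ 2 := by simp [Finset.sum_add_distrib]
    _ ≤ k.choose 2 + k ^ 2 := by
        simpa using sum_choose_two_le_of_card_inter_le_one N hN
end

section
/- Let d, k ≥ 2. Let H be a d-uniform d-partite hypergraph with pairwise disjoint vertex parts X_1, ..., X_d of sizes |X_i| = k^{2^{i−1}}, whose edges are transversals (sets containing exactly one vertex from each part). If H contains no copy of K_{d∗2}, i.e., there is no choice of two distinct vertices in each part X_i such that all 2^d transversals formed from these vertices are edges of H, then H has fewer than (2 − 1/2^{d−1}) · k^{2^d − 2} edges. -/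
open Finset in
/-- If every family of more than `M` transversals contains a box with all sides of size two, then a
family `L` of transversals contains at least `#L - M` such boxes. -/
theorem card_le_add_card_boxes {ι : Type*} [Fintype ι] [DecidableEq ι] {α : ι → Type*}
    [∀ i, Fintype (α i)] [∀ i, DecidableEq (α i)] {M : ℝ}
    (hM : ∀ L : Finset (∀ i, α i),
      (∀ S : ∀ i, Finset (α i), (∀ i, #(S i) = 2) → ¬ Fintype.piFinset S ⊆ L) → (#L : ℝ) ≤ M)
    (L : Finset (∀ i, α i)) :
    (#L : ℝ) ≤ M + #{S ∈ Fintype.piFinset fun i => powersetCard 2 (univ : Finset (α i)) |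
      Fintype.piFinset S ⊆ L} := by
  induction L using Finset.strongInduction with
  | H L ih =>
    by_cases hL : ∀ S : ∀ i, Finset (α i), (∀ i, #(S i) = 2) → ¬ Fintype.piFinset S ⊆ L
    · exact (hM L hL).trans (le_add_of_nonneg_right (Nat.cast_nonneg _))
    · push Not at hL
      obtain ⟨S, hS, hSL⟩ := hL
      have hne : (Fintype.piFinset S).Nonempty :=
        Fintype.piFinset_nonempty.2 fun i => card_pos.1 (by simp [hS i])
      obtain ⟨x, hx⟩ := hne
      have hxL := hSL hx
      have hlt : #{S ∈ Fintype.piFinset fun i => powersetCard 2 (univ : Finset (α i)) |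
            Fintype.piFinset S ⊆ L.erase x} <
          #{S ∈ Fintype.piFinset fun i => powersetCard 2 (univ : Finset (α i)) |
            Fintype.piFinset S ⊆ L} := by
        refine card_lt_card (ssubset_iff_of_subset ?_ |>.2 ⟨S, ?_, ?_⟩)
        · exact monotone_filter_right _ fun T _ hT => hT.trans (erase_subset _ _)
        · simp [hS, hSL, mem_powersetCard]
        · simp only [mem_filter, not_and]
          exact fun _ h => notMem_erase x L (h hx)
      have hcard := card_erase_add_one hxL
      have := ih _ (erase_ssubset hxL)
      have hlt' : ((#{S ∈ Fintype.piFinset fun i => powersetCard 2 (univ : Finset (α i)) |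
            Fintype.piFinset S ⊆ L.erase x} + 1 : ℕ) : ℝ) ≤
          #{S ∈ Fintype.piFinset fun i => powersetCard 2 (univ : Finset (α i)) |
            Fintype.piFinset S ⊆ L} := by exact_mod_cast hlt
      have hcard' : (#(L.erase x) : ℝ) + 1 = #L := by exact_mod_cast hcard
      push_cast at hlt'
      linarith

open Finset in
/-- Adding one part to a box-free family: bound the links of the vertices of the last part, using
that every box lies in the link of at most one vertex. -/
theorem card_le_of_box_free_succ {d : ℕ} {α : Fin (d + 1) → Type*}
    [∀ i, Fintype (α i)] [∀ i, DecidableEq (α i)] {M : ℝ}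
    (hM : ∀ L : Finset (∀ i : Fin d, α i.castSucc),
      (∀ S : ∀ i : Fin d, Finset (α i.castSucc), (∀ i, #(S i) = 2) →
        ¬ Fintype.piFinset S ⊆ L) → (#L : ℝ) ≤ M)
    (H : Finset (∀ i, α i))
    (hH : ∀ S : ∀ i, Finset (α i), (∀ i, #(S i) = 2) → ¬ Fintype.piFinset S ⊆ H) :
    (#H : ℝ) ≤ Fintype.card (α (Fin.last d)) * M +
      ∏ i : Fin d, ((Fintype.card (α i.castSucc)).choose 2 : ℝ) := by
  let link (v : α (Fin.last d)) : Finset (∀ i : Fin d, α i.castSucc) :=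
    {f | Fin.snoc f v ∈ H}
  let boxes (v : α (Fin.last d)) : Finset (∀ i : Fin d, Finset (α i.castSucc)) :=
    {S ∈ Fintype.piFinset fun i : Fin d => powersetCard 2 (univ : Finset (α i.castSucc)) |
      Fintype.piFinset S ⊆ link v}
  have hsum : #H = ∑ v, #(link v) := by
    rw [card_eq_sum_card_fiberwise (f := fun h => h (Fin.last d)) (t := univ) (by simp)]
    refine sum_congr rfl fun v _ => ?_
    refine card_bij' (fun h _ => Fin.init h) (fun f _ => Fin.snoc f v) ?_ ?_ ?_ ?_
    · intro h hh
      obtain ⟨hh, rfl⟩ := mem_filter.1 hh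
      simpa [link] using hh
    · intro f hf
      simpa [link] using hf
    · intro h hh
      obtain ⟨hh, rfl⟩ := mem_filter.1 hh
      simp
    · intro f hf
      simp
  have hdisj : Set.PairwiseDisjoint (univ : Finset (α (Fin.last d))) boxes := by
    intro v _ w _ hvw
    refine disjoint_left.2 fun S hv hw => ?_
    simp only [boxes, mem_filter, Fintype.mem_piFinset, mem_powersetCard] at hv hw
    refine hH (Fin.snoc (α := fun i => Finset (α i)) S {v, w}) ?_ ?_
    · intro i
      refine Fin.lastCases ?_ (fun j => ?_) i
      · simpa using card_pair hvw
      · simpa using (hv.1 j).2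
    · intro h hh
      rw [Fintype.mem_piFinset] at hh
      have hinit : Fin.init h ∈ Fintype.piFinset S := by
        rw [Fintype.mem_piFinset]
        intro j
        simpa [Fin.init] using hh j.castSucc
      have hlast : h (Fin.last d) = v ∨ h (Fin.last d) = w := by
        simpa using hh (Fin.last d)
      rcases hlast with e | e
      · have := hv.2 hinit
        simpa [link, ← e] using this
      · have := hw.2 hinit
        simpa [link, ← e] using this
  have hboxes : ∑ v, #(boxes v) ≤ ∏ i : Fin d, (Fintype.card (α i.castSucc)).choose 2 := by
    rw [← card_biUnion hdisj]
    refine (card_le_card (biUnion_subset.2 fun v _ => filter_subset _ _)).trans ?_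
    simp [Fintype.card_piFinset]
  calc (#H : ℝ) = ∑ v, (#(link v) : ℝ) := by exact_mod_cast hsum
    _ ≤ ∑ v, (M + #(boxes v)) := sum_le_sum fun v _ => card_le_add_card_boxes hM _
    _ = Fintype.card (α (Fin.last d)) * M + ∑ v, (#(boxes v) : ℝ) := by
      simp [sum_add_distrib]
    _ ≤ _ := by gcongr; exact_mod_cast hboxes

theorem prod_pow_two_pow_sq_div_two {k : ℝ} (hk : k ≠ 0) (d : ℕ) :
    ∏ i : Fin d, (k ^ 2 ^ (i : ℕ)) ^ 2 / 2 = (k ^ 2 ^ d / k) ^ 2 / 2 ^ d := by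
  induction d with
  | zero => simp [hk]
  | succ d ih =>
    rw [Fin.prod_univ_castSucc]
    simp only [Fin.val_castSucc, Fin.val_last, ih]
    rw [pow_succ (2 : ℕ) d, pow_mul k, pow_succ (2 : ℝ) d]
    field_simp

theorem choose_two_le_sq_div_two (n : ℕ) : (n.choose 2 : ℝ) ≤ (n : ℝ) ^ 2 / 2 := by
  rw [Nat.cast_choose_two]
  have : (0 : ℝ) ≤ n := n.cast_nonneg
  nlinarith

theorem prod_choose_two_le {k : ℕ} (hk : k ≠ 0) (d : ℕ) :
    ∏ i : Fin d, ((k ^ 2 ^ (i : ℕ)).choose 2 : ℝ) ≤ ((k : ℝ) ^ 2 ^ d / k) ^ 2 / 2 ^ d := by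
  rw [← prod_pow_two_pow_sq_div_two (Nat.cast_ne_zero.2 hk)]
  refine Finset.prod_le_prod (fun _ _ => Nat.cast_nonneg _) fun i _ => ?_
  exact_mod_cast choose_two_le_sq_div_two (k ^ 2 ^ (i : ℕ))

theorem prod_choose_two_lt {k : ℕ} (hk : 2 ≤ k) {d : ℕ} (hd : d ≠ 0) :
    ∏ i : Fin d, ((k ^ 2 ^ (i : ℕ)).choose 2 : ℝ) < ((k : ℝ) ^ 2 ^ d / k) ^ 2 / 2 ^ d := by
  have : NeZero d := ⟨hd⟩
  rw [← prod_pow_two_pow_sq_div_two (Nat.cast_ne_zero.2 (by lia))]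
  refine Finset.prod_lt_prod_of_nonempty (fun i _ => ?_) (fun i _ => ?_) Finset.univ_nonempty
  · exact_mod_cast Nat.choose_pos (hk.trans (Nat.le_self_pow (by positivity) k))
  · rw [Nat.cast_choose_two]
    have : (0 : ℝ) < (k : ℝ) ^ 2 ^ (i : ℕ) := by positivity
    push_cast
    nlinarith

open Finset in
theorem card_le_of_box_free {k : ℕ} (hk : k ≠ 0) (d : ℕ)
    (H : Finset (∀ i : Fin d, Fin (k ^ 2 ^ (i : ℕ))))
    (hH : ∀ S : ∀ i : Fin d, Finset (Fin (k ^ 2 ^ (i : ℕ))), (∀ i, #(S i) = 2) →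
      ¬ Fintype.piFinset S ⊆ H) :
    (#H : ℝ) ≤ (2 - 2 / 2 ^ d) * ((k : ℝ) ^ 2 ^ d / k ^ 2) := by
  induction d with
  | zero =>
    have : H = ∅ := by
      refine eq_empty_of_forall_notMem fun x hx => hH (fun i => i.elim0) (fun i => i.elim0) ?_
      intro y _
      rwa [Subsingleton.elim y x]
    simp [this]
  | succ d ih =>
    have hk' : (k : ℝ) ≠ 0 := Nat.cast_ne_zero.2 hk
    refine (card_le_of_box_free_succ (α := fun i : Fin (d + 1) => Fin (k ^ 2 ^ (i : ℕ)))
      ih H hH).trans ?_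
    simp only [Fintype.card_fin, Fin.val_last, Fin.val_castSucc]
    refine (add_le_add_right (prod_choose_two_le hk d) _).trans_eq ?_
    rw [pow_succ (2 : ℕ) d, pow_mul (k : ℝ), pow_succ (2 : ℝ) d]
    push_cast
    field_simp
    ring

theorem kd2_free_hypergraph_bound (d k : ℕ) (hd : 2 ≤ d) (hk : 2 ≤ k)
    (H : Finset (∀ i : Fin d, Fin (k ^ 2 ^ (i : ℕ))))
    (hH : ¬ ∃ f g : ∀ i : Fin d, Fin (k ^ 2 ^ (i : ℕ)),
      (∀ i, f i ≠ g i) ∧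
      ∀ h : Fin d → Bool, (fun i => if h i then f i else g i) ∈ H) :
    (H.card : ℝ) < (2 - 1 / (2 : ℝ) ^ (d - 1)) * (k : ℝ) ^ (2 ^ d - 2) := by
  have hfree : ∀ S : ∀ i : Fin d, Finset (Fin (k ^ 2 ^ (i : ℕ))), (∀ i, (S i).card = 2) →
      ¬ Fintype.piFinset S ⊆ H := by
    intro S hS hSH
    choose f g hfg hSfg using fun i => Finset.card_eq_two.1 (hS i)
    refine hH ⟨f, g, hfg, fun h => hSH (Fintype.mem_piFinset.2 fun i => ?_)⟩
    rw [hSfg]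
    split_ifs <;> simp
  obtain ⟨d, rfl⟩ : ∃ e, d = e + 1 := ⟨d - 1, by lia⟩
  have hk₀ : k ≠ 0 := by lia
  have hk' : (k : ℝ) ≠ 0 := Nat.cast_ne_zero.2 hk₀
  refine (card_le_of_box_free_succ (α := fun i : Fin (d + 1) => Fin (k ^ 2 ^ (i : ℕ)))
    (card_le_of_box_free hk₀ d) H hfree).trans_lt ?_
  simp only [Fintype.card_fin, Fin.val_last, Fin.val_castSucc]
  refine (add_lt_add_right (prod_choose_two_lt hk (by lia)) _).trans_eq ?_
  have hexp : 2 ≤ 2 ^ (d + 1) := Nat.le_self_pow (by lia) 2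
  rw [pow_sub₀ _ hk' hexp, pow_succ 2 d, pow_mul (k : ℝ), Nat.add_sub_cancel]
  push_cast
  field_simp
  ring
end

section
/- For every integer a ≥ 2 and every positive integer m, every family of m distinct finite sets contains an a-union-free subfamily of size at least √(2m) − 1/2. -/
/-- A family `F` is `a`-union free: no `a` distinct members of `F` have union equal to
another member of `F` (i.e. there are no `a+1` distinct sets `F₁, …, F_{a+1}` in `F`
with `F₁ ∪ ⋯ ∪ F_a = F_{a+1}`). -/
def IsUnionFree {α : Type*} [DecidableEq α] (a : ℕ) (F : Finset (Finset α)) : Prop :=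
  ∀ S : Finset (Finset α), S ⊆ F → S.card = a → ∀ T ∈ F, T ∉ S → S.sup id ≠ T

/-- A finite subset of a partial order with more than `k * (k + 1) / 2` elements contains an
antichain `A` and a chain `C`, of total size greater than `k`, such that no element of `A` lies
below an element of `C`. -/
theorem exists_antichain_chain_of_card_lt {β : Type*} [PartialOrder β] [DecidableEq β]
    (k : ℕ) (G : Finset β) (hG : k * (k + 1) < 2 * G.card) :
    ∃ A ⊆ G, ∃ C ⊆ G, IsAntichain (· ≤ ·) (A : Set β) ∧ IsChain (· ≤ ·) (C : Set β) ∧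
      (∀ x ∈ A, ∀ y ∈ C, ¬ x ≤ y) ∧ (∃ z ∈ G, ∀ y ∈ C, z ≤ y) ∧ k < A.card + C.card := by
  classical
  induction k generalizing G with
  | zero =>
    obtain ⟨g, hg⟩ : G.Nonempty := Finset.card_pos.1 (by omega)
    exact ⟨{g}, by simpa using hg, ∅, by simp, by simp, by simp, by simp, ⟨g, hg, by simp⟩,
      by simp⟩
  | succ k ih =>
    obtain ⟨g, hg⟩ : G.Nonempty := Finset.card_pos.1 (by nlinarith)
    set M := G.filter (fun x => Minimal (· ∈ G) x)
    have hMG : M ⊆ G := Finset.filter_subset _ _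
    by_cases hk : k + 1 < M.card
    · refine ⟨M, hMG, ∅, by simp, ?_, by simp, by simp, ⟨g, hg, by simp⟩, by simpa using hk⟩
      intro x hx y hy hxy hle
      have hy' := (Finset.mem_filter.1 (Finset.mem_coe.1 hy)).2
      exact hxy (hy'.eq_of_le (hMG hx) hle)
    · have hcard : (G \ M).card + M.card = G.card := Finset.card_sdiff_add_card_eq_card hMG
      obtain ⟨A, hA, C, hC, hAA, hCC, hAC, ⟨z, hz, hzC⟩, hlt⟩ := ih (G \ M) (by nlinarith)
      obtain ⟨w, hwz, hw⟩ := G.exists_le_minimal (Finset.sdiff_subset hz)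
      have hwM : w ∈ M := Finset.mem_filter.2 ⟨hw.prop, hw⟩
      have hwC : w ∉ C := fun h => (Finset.mem_sdiff.1 (hC h)).2 hwM
      refine ⟨A, hA.trans Finset.sdiff_subset, insert w C,
        Finset.insert_subset hw.prop (hC.trans Finset.sdiff_subset), hAA, ?_, ?_,
        ⟨w, hw.prop, ?_⟩, ?_⟩
      · rw [Finset.coe_insert]
        exact hCC.insert fun y hy _ => Or.inl (hwz.trans (hzC y hy))
      · intro x hx y hy hxy
        obtain rfl | hy := Finset.mem_insert.1 hy
        · have hxG := Finset.mem_sdiff.1 (hA hx)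
          exact hxG.2 (hw.eq_of_le hxG.1 hxy ▸ hwM)
        · exact hAC x hx y hy hxy
      · intro y hy
        obtain rfl | hy := Finset.mem_insert.1 hy
        · exact le_rfl
        · exact hwz.trans (hzC y hy)
      · rw [Finset.card_insert_of_notMem hwC]
        omega

/-- The union of an antichain and a chain, no member of the antichain lying below a member of the
chain, is `a`-union free for every `a ≠ 0`. -/
theorem isUnionFree_union {α : Type*} [DecidableEq α] {a : ℕ} (ha : a ≠ 0)
    {A C : Finset (Finset α)} (hA : IsAntichain (· ≤ ·) (A : Set (Finset α)))
    (hC : IsChain (· ≤ ·) (C : Set (Finset α))) (hAC : ∀ x ∈ A, ∀ y ∈ C, ¬ x ≤ y) :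
    IsUnionFree a (A ∪ C) := by
  intro S hS hSa T hT hTS hsup
  have hle : ∀ x ∈ S, x ≤ T := fun x hx => hsup ▸ Finset.le_sup (f := id) hx
  have hSC : ∀ x ∈ S, x ∈ C := by
    intro x hx
    refine (Finset.mem_union.1 (hS hx)).resolve_left fun hxA => ?_
    obtain hTA | hTC := Finset.mem_union.1 hT
    · exact hA hxA hTA (fun h => hTS (h ▸ hx)) (hle x hx)
    · exact hAC x hxA T hTC (hle x hx)
  have hne : S.Nonempty := Finset.card_pos.1 (by omega)
  obtain ⟨x, hx⟩ := S.exists_maximal hne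
  have hTx : T ≤ x := hsup ▸ Finset.sup_le fun y hy =>
    (hC.total (hSC y hy) (hSC x hx.prop)).elim id (hx.le_of_ge hy)
  exact hTS (le_antisymm hTx (hle x hx.prop) ▸ hx.prop)

theorem union_free_lower_bound {α : Type*} [DecidableEq α]
    (a : ℕ) (ha : 2 ≤ a) (m : ℕ) (hm : 0 < m)
    (F : Finset (Finset α)) (hF : F.card = m) :
    ∃ G ⊆ F, IsUnionFree a G ∧ Real.sqrt (2 * m) - 1 / 2 ≤ (G.card : ℝ) := by
  have hex : ∃ n : ℕ, 2 * m ≤ n * (n + 1) := ⟨2 * m, by nlinarith⟩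
  obtain ⟨k, hk, hkm⟩ : ∃ k : ℕ, 2 * m ≤ (k + 1) * (k + 2) ∧ k * (k + 1) < 2 * m := by
    obtain ⟨k, hk⟩ : ∃ k, Nat.find hex = k + 1 :=
      Nat.exists_eq_succ_of_ne_zero fun h => by
        have := Nat.find_spec hex
        rw [h] at this
        omega
    refine ⟨k, ?_, not_le.1 (Nat.find_min hex (by omega))⟩
    simpa only [hk] using Nat.find_spec hex
  obtain ⟨A, hA, C, hC, hAA, hCC, hAC, -, hlt⟩ :=
    exists_antichain_chain_of_card_lt k F (hF ▸ hkm)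
  refine ⟨A ∪ C, Finset.union_subset hA hC, isUnionFree_union (by omega) hAA hCC hAC, ?_⟩
  rw [Finset.card_union_of_disjoint
    (Finset.disjoint_left.2 fun x hxA hxC => hAC x hxA x hxC le_rfl)]
  have hk' : (2 * m : ℝ) ≤ (k + 1) * (k + 2) := mod_cast hk
  have hlt' : (k : ℝ) + 1 ≤ (A.card + C.card : ℕ) := mod_cast hlt
  have hsqrt : Real.sqrt (2 * m) ≤ k + 1 + 1 / 2 :=
    Real.sqrt_le_iff.2 ⟨by positivity, by nlinarith⟩
  linarith
end

section
/- Let a ≥ 2 and let F be a family of m distinct finite sets in which the longest chain under inclusion has ℓ members. Then F contains an a-union-free subfamily of size at least m/ℓ + (ℓ−1)/2. -/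
open Classical in
/-- The largest size of a chain of members of `F` that are contained in `T`. -/
noncomputable def chainRank {α : Type*} (F : Finset (Finset α)) (T : Finset α) : ℕ :=
  ((F.filter (· ⊆ T)).powerset.filter
    (fun C : Finset (Finset α) => IsChain (· ⊆ ·) (↑C : Set (Finset α)))).sup Finset.card

lemma card_le_chainRank {α : Type*} {F C : Finset (Finset α)} {T : Finset α}
    (hCF : C ⊆ F) (hCT : ∀ s ∈ C, s ⊆ T) (hC : IsChain (· ⊆ ·) (↑C : Set (Finset α))) :
    C.card ≤ chainRank F T := by
  classical
  unfold chainRank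
  refine Finset.le_sup (f := Finset.card) ?_
  simp only [Finset.mem_filter, Finset.mem_powerset]
  exact ⟨fun s hs => Finset.mem_filter.2 ⟨hCF hs, hCT s hs⟩, hC⟩

lemma exists_chain_card_eq_chainRank {α : Type*} (F : Finset (Finset α)) (T : Finset α) :
    ∃ C ⊆ F, (∀ s ∈ C, s ⊆ T) ∧ IsChain (· ⊆ ·) (↑C : Set (Finset α)) ∧
      C.card = chainRank F T := by
  classical
  unfold chainRank
  obtain ⟨C, hC, h⟩ := Finset.exists_mem_eq_sup
    ((F.filter (· ⊆ T)).powerset.filter (fun C : Finset (Finset α) => IsChain (· ⊆ ·) (↑C : Set (Finset α))))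
    ⟨∅, by simp⟩ Finset.card
  simp only [Finset.mem_filter, Finset.mem_powerset] at hC
  exact ⟨C, fun s hs => (Finset.mem_filter.1 (hC.1 hs)).1,
    fun s hs => (Finset.mem_filter.1 (hC.1 hs)).2, hC.2, by convert h.symm⟩

lemma chainRank_mono {α : Type*} (F : Finset (Finset α)) {S T : Finset α} (h : S ⊆ T) :
    chainRank F S ≤ chainRank F T := by
  obtain ⟨C, hCF, hCS, hC, hcard⟩ := exists_chain_card_eq_chainRank F S
  exact hcard ▸ card_le_chainRank hCF (fun s hs => (hCS s hs).trans h) hC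

lemma chainRank_lt_chainRank {α : Type*} [DecidableEq α] {F : Finset (Finset α)}
    {S T : Finset α} (hT : T ∈ F) (h : S ⊂ T) : chainRank F S < chainRank F T := by
  obtain ⟨C, hCF, hCS, hC, hcard⟩ := exists_chain_card_eq_chainRank F S
  have hTC : T ∉ C := fun hTC => h.2 (hCS T hTC)
  have := card_le_chainRank (F := F) (C := insert T C) (T := T)
    (Finset.insert_subset hT hCF)
    (fun s hs => by
      rcases Finset.mem_insert.1 hs with rfl | hs
      · exact subset_rfl
      · exact (hCS s hs).trans h.1)
    (by
      rw [Finset.coe_insert]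
      exact hC.insert fun s hs _ => Or.inr ((hCS s hs).trans h.1))
  rw [Finset.card_insert_of_notMem hTC] at this
  omega

lemma sup_mem_of_isChain {α : Type*} [DecidableEq α] {S : Finset (Finset α)}
    (hne : S.Nonempty) (hS : IsChain (· ⊆ ·) (↑S : Set (Finset α))) : S.sup id ∈ S := by
  obtain ⟨M, hM, hmax⟩ := S.exists_max_image Finset.card hne
  suffices S.sup id = M by rwa [this]
  refine le_antisymm (Finset.sup_le fun s hs => ?_) (Finset.le_sup (f := id) hM)
  rcases hS.total hs hM with h | h
  · exact h
  · exact (Finset.eq_of_subset_of_card_le h (hmax s hs)).ge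

/-- A level set of `chainRank` together with a longest chain below one of its members
is union free. -/
lemma exists_isUnionFree_of_mem {α : Type*} [DecidableEq α] {a : ℕ} (ha : a ≠ 0)
    {F : Finset (Finset α)} {x : Finset α} (hx : x ∈ F) :
    ∃ G ⊆ F, IsUnionFree a G ∧
      (F.filter (fun T => chainRank F T = chainRank F x)).card + chainRank F x ≤ G.card + 1 := by
  obtain ⟨D, hDF, hDx, hD, hcard⟩ := exists_chain_card_eq_chainRank F x
  set A := F.filter (fun T => chainRank F T = chainRank F x) with hA
  have hGF : A ∪ D ⊆ F := Finset.union_subset (Finset.filter_subset _ _) hDF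
  refine ⟨A ∪ D, hGF, ?_, ?_⟩
  · intro S hS hSa T hT hTS hsup
    have hrank : chainRank F T ≤ chainRank F x := by
      rcases Finset.mem_union.1 hT with h | h
      · exact (Finset.mem_filter.1 h).2.le
      · exact chainRank_mono F (hDx T h)
    have hSD : S ⊆ D := by
      intro s hs
      have hsT : s ⊂ T := by
        refine (hsup ▸ Finset.le_sup (f := id) hs : s ⊆ T).ssubset_of_ne ?_
        rintro rfl
        exact hTS hs
      have hlt := chainRank_lt_chainRank (hGF hT) hsT
      refine (Finset.mem_union.1 (hS hs)).resolve_left fun h => ?_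
      have := (Finset.mem_filter.1 h).2
      omega
    refine hTS (hsup ▸ sup_mem_of_isChain (Finset.card_pos.1 (by omega)) (hD.mono ?_))
    exact_mod_cast hSD
  · have hinter : A ∩ D ⊆ {x} := by
      intro s hs
      obtain ⟨hsA, hsD⟩ := Finset.mem_inter.1 hs
      rw [Finset.mem_singleton]
      by_contra hne
      have := chainRank_lt_chainRank hx ((hDx s hsD).ssubset_of_ne hne)
      have := (Finset.mem_filter.1 hsA).2
      omega
    have h1 := Finset.card_le_card hinter
    have h2 := Finset.card_union_add_card_inter A D
    rw [Finset.card_singleton] at h1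
    omega

theorem union_free_chain_bound {α : Type*} [DecidableEq α]
    (a : ℕ) (ha : 2 ≤ a) (m ℓ : ℕ)
    (F : Finset (Finset α)) (hF : F.card = m)
    (hchain : ∃ C ⊆ F, IsChain (· ⊆ ·) (↑C : Set (Finset α)) ∧ C.card = ℓ)
    (hmax : ∀ C ⊆ F, IsChain (· ⊆ ·) (↑C : Set (Finset α)) → C.card ≤ ℓ) :
    ∃ G ⊆ F, IsUnionFree a G ∧ (m : ℝ) / ℓ + ((ℓ : ℝ) - 1) / 2 ≤ (G.card : ℝ) := by
  rcases Nat.eq_zero_or_pos ℓ with rfl | hℓ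
  · refine ⟨∅, by simp, fun S _ _ T hT => by simp at hT, ?_⟩
    norm_num
  have hmaps : ∀ T ∈ F, chainRank F T ∈ Finset.Icc 1 ℓ := by
    intro T hT
    rw [Finset.mem_Icc]
    constructor
    · simpa using card_le_chainRank (F := F) (C := {T}) (T := T) (by simpa using hT)
        (by simp) (by simp)
    · obtain ⟨C, hCF, -, hC, hcard⟩ := exists_chain_card_eq_chainRank F T
      exact hcard ▸ hmax C hCF hC
  obtain ⟨C, hCF, hC, hCcard⟩ := hchain
  have hinj : Set.InjOn (chainRank F) (↑C : Set (Finset α)) := by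
    intro s hs t ht hst
    by_contra hne
    rcases hC hs ht hne with h | h
    · exact (chainRank_lt_chainRank (hCF ht) (h.ssubset_of_ne hne)).ne hst
    · exact (chainRank_lt_chainRank (hCF hs) (h.ssubset_of_ne (Ne.symm hne))).ne hst.symm
  have hsurj : C.image (chainRank F) = Finset.Icc 1 ℓ := by
    refine Finset.eq_of_subset_of_card_le
      (Finset.image_subset_iff.2 fun T hT => hmaps T (hCF hT)) ?_
    rw [Finset.card_image_of_injOn hinj, hCcard, Nat.card_Icc, Nat.add_sub_cancel]
  have hsum : ∑ i ∈ Finset.Icc 1 ℓ, (F.filter (fun T => chainRank F T = i)).card = m := by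
    rw [← hF, Finset.card_eq_sum_card_fiberwise hmaps]
  have hgauss : ∀ n : ℕ, ∑ i ∈ Finset.Icc 1 n, ((i : ℝ) - 1) = n * ((n : ℝ) - 1) / 2 := by
    intro n
    induction n with
    | zero => simp
    | succ n ih =>
      rw [Finset.sum_Icc_succ_top (by omega), ih]
      push_cast
      ring
  have hℓ' : (ℓ : ℝ) ≠ 0 := by positivity
  obtain ⟨i, hi, hle⟩ := Finset.exists_le_of_sum_le (s := Finset.Icc 1 ℓ)
    (f := fun _ => (m : ℝ) / ℓ + ((ℓ : ℝ) - 1) / 2)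
    (g := fun i => ((F.filter (fun T => chainRank F T = i)).card : ℝ) + ((i : ℝ) - 1))
    ⟨1, Finset.mem_Icc.2 ⟨le_rfl, hℓ⟩⟩ (by
      rw [Finset.sum_add_distrib (f := fun i => ((F.filter (fun T => chainRank F T = i)).card : ℝ)),
        hgauss, ← Nat.cast_sum, hsum, Finset.sum_const,
        Nat.card_Icc, Nat.add_sub_cancel, nsmul_eq_mul]
      apply le_of_eq
      field_simp)
  rw [← hsurj] at hi
  obtain ⟨x, hx, rfl⟩ := Finset.mem_image.1 hi
  obtain ⟨G, hGF, hG, hcard⟩ := exists_isUnionFree_of_mem (a := a) (by omega) (hCF hx)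
  refine ⟨G, hGF, hG, hle.trans ?_⟩
  have : ((F.filter (fun T => chainRank F T = chainRank F x)).card : ℝ) + chainRank F x
      ≤ G.card + 1 := by exact_mod_cast hcard
  linarith
end

section
/- Let a ≥ 2, k ≥ 1, and let ∅ ≠ A_1 ⊂ A_2 ⊂ ... ⊂ A_k and ∅ ≠ B_1 ⊂ B_2 ⊂ ... ⊂ B_k be two chains of finite sets (strict inclusions) with A_k ∩ B_k = ∅, and let F_ES(k) = {A_i ∪ B_j : 1 ≤ i, j ≤ k}. Then every a-union-free subfamily G of F_ES(k) satisfies |G| ≤ 2(⌈√(a+1)⌉ − 1) · k. -/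
/-- Points with fewer than `m` points of `P` below them in their own `f`-fibre, where heights are
measured by `g`. -/
def lowPoints {β : Type*} (f g : β → ℕ) (m : ℕ) (P : Finset β) : Finset β :=
  P.filter fun p => (P.filter fun q => f q = f p ∧ g q < g p).card < m

theorem lowPoints_subset {β : Type*} (f g : β → ℕ) (m : ℕ) (P : Finset β) :
    lowPoints f g m P ⊆ P :=
  Finset.filter_subset _ _

theorem card_lowPoints_le {β : Type*} [DecidableEq β] (f g : β → ℕ)
    (hfg : ∀ p q, f p = f q → g p = g q → p = q) (m k : ℕ) (P : Finset β)
    (hP : ∀ p ∈ P, f p ∈ Finset.Icc 1 k) : (lowPoints f g m P).card ≤ m * k := by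
  have h := Finset.card_le_mul_card_image_of_maps_to (f := f) (s := lowPoints f g m P)
    (t := Finset.Icc 1 k) (fun p hp => hP p (lowPoints_subset f g m P hp)) m ?_
  · simpa using h
  intro x _
  by_contra! hcard
  obtain ⟨p, hp, hmax⟩ := Finset.exists_max_image
    ((lowPoints f g m P).filter fun q => f q = x) g (Finset.card_pos.mp (by omega))
  have hp' := Finset.mem_filter.mp hp
  have hlow := (Finset.mem_filter.mp hp'.1).2
  have hsub : ((lowPoints f g m P).filter fun q => f q = x).erase p ⊆
      P.filter fun q => f q = f p ∧ g q < g p := by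
    intro q hq
    obtain ⟨hne, hq⟩ := Finset.mem_erase.mp hq
    have hq' := Finset.mem_filter.mp hq
    have hf : f q = f p := hq'.2.trans hp'.2.symm
    exact Finset.mem_filter.mpr ⟨lowPoints_subset f g m P hq'.1, hf,
      lt_of_le_of_ne (hmax q hq) fun hg => hne (hfg q p hf hg)⟩
  have hle := Finset.card_le_card hsub
  rw [Finset.card_erase_of_mem hp] at hle
  omega

/-- A planar point set with more than `2 * m * k` points in a `k × k` grid has a point `t` that
dominates `(m + 1) ^ 2` points, including another one in its row and another one in its column. -/
theorem exists_dominating_point (m k : ℕ) (hm : 1 ≤ m) (P : Finset (ℕ × ℕ))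
    (hP : P ⊆ Finset.Icc 1 k ×ˢ Finset.Icc 1 k) (hcard : 2 * m * k < P.card) :
    ∃ t ∈ P, (∃ u ∈ P, u.1 = t.1 ∧ u.2 < t.2) ∧ (∃ v ∈ P, v.2 = t.2 ∧ v.1 < t.1) ∧
      (m + 1) ^ 2 ≤ (P.filter fun q => q.1 ≤ t.1 ∧ q.2 ≤ t.2).card := by
  set Q := P \ lowPoints Prod.fst Prod.snd m P with hQ
  have hQP : Q ⊆ P := Finset.sdiff_subset
  have h1 := card_lowPoints_le (Prod.fst : ℕ × ℕ → ℕ) Prod.snd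
    (fun p q h h' => Prod.ext h h') m k P (fun p hp => (Finset.mem_product.mp (hP hp)).1)
  have h2 := card_lowPoints_le (Prod.snd : ℕ × ℕ → ℕ) Prod.fst
    (fun p q h h' => Prod.ext h' h) m k Q (fun p hp => (Finset.mem_product.mp (hP (hQP hp))).2)
  have h3 : P.card - (lowPoints Prod.fst Prod.snd m P).card ≤ Q.card :=
    Finset.le_card_sdiff _ _
  have h4 : (lowPoints Prod.snd Prod.fst m Q).card < Q.card := by
    have : 2 * m * k = m * k + m * k := by ring
    omega
  obtain ⟨t, htQ, ht⟩ := Finset.exists_mem_notMem_of_card_lt_card h4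
  have below : ∀ r ∈ Q, m ≤ (P.filter fun q => q.1 = r.1 ∧ q.2 < r.2).card := by
    intro r hr
    have hr' := Finset.mem_sdiff.mp hr
    by_contra! hlt
    exact hr'.2 (Finset.mem_filter.mpr ⟨hr'.1, hlt⟩)
  have left : m ≤ (Q.filter fun q => q.2 = t.2 ∧ q.1 < t.1).card := by
    by_contra! hlt
    exact ht (Finset.mem_filter.mpr ⟨htQ, hlt⟩)
  refine ⟨t, hQP htQ, ?_, ?_, ?_⟩
  · obtain ⟨u, hu⟩ := Finset.card_pos.mp (hm.trans (below t htQ))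
    exact ⟨u, (Finset.mem_filter.mp hu).1, (Finset.mem_filter.mp hu).2⟩
  · obtain ⟨v, hv⟩ := Finset.card_pos.mp (hm.trans left)
    exact ⟨v, hQP (Finset.mem_filter.mp hv).1, (Finset.mem_filter.mp hv).2⟩
  set R := insert t (Q.filter fun q => q.2 = t.2 ∧ q.1 < t.1) with hR
  have hRcard : m + 1 ≤ R.card := by
    rw [hR, Finset.card_insert_of_notMem (by simp)]
    omega
  have hRmem : ∀ r ∈ R, r ∈ Q ∧ r.2 = t.2 ∧ r.1 ≤ t.1 := by
    intro r hr
    rcases Finset.mem_insert.mp hr with rfl | hr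
    · exact ⟨htQ, rfl, le_rfl⟩
    · have := Finset.mem_filter.mp hr
      exact ⟨this.1, this.2.1, this.2.2.le⟩
  have hdisj : (R : Set (ℕ × ℕ)).PairwiseDisjoint
      fun r => P.filter fun q => q.1 = r.1 ∧ q.2 ≤ r.2 := by
    intro r hr r' hr' hne
    refine Finset.disjoint_left.mpr fun q hq hq' => hne (Prod.ext ?_ ?_)
    · exact (Finset.mem_filter.mp hq).2.1.symm.trans (Finset.mem_filter.mp hq').2.1
    · exact (hRmem r hr).2.1.trans (hRmem r' hr').2.1.symm
  have hcol : ∀ r ∈ R, m + 1 ≤ (P.filter fun q => q.1 = r.1 ∧ q.2 ≤ r.2).card := by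
    intro r hr
    have hrQ := (hRmem r hr).1
    have hsub : insert r (P.filter fun q => q.1 = r.1 ∧ q.2 < r.2) ⊆
        P.filter fun q => q.1 = r.1 ∧ q.2 ≤ r.2 := by
      intro q hq
      rcases Finset.mem_insert.mp hq with rfl | hq
      · exact Finset.mem_filter.mpr ⟨hQP hrQ, rfl, le_rfl⟩
      · have := Finset.mem_filter.mp hq
        exact Finset.mem_filter.mpr ⟨this.1, this.2.1, this.2.2.le⟩
    have hle := Finset.card_le_card hsub
    rw [Finset.card_insert_of_notMem (by simp)] at hle
    have := below r hrQ
    omega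
  calc (m + 1) ^ 2 = (m + 1) * (m + 1) := sq _
    _ ≤ R.card * (m + 1) := Nat.mul_le_mul_right _ hRcard
    _ ≤ ∑ r ∈ R, (P.filter fun q => q.1 = r.1 ∧ q.2 ≤ r.2).card := by
      simpa using Finset.card_nsmul_le_sum R _ (m + 1) hcol
    _ = (R.biUnion fun r => P.filter fun q => q.1 = r.1 ∧ q.2 ≤ r.2).card :=
      (Finset.card_biUnion hdisj).symm
    _ ≤ _ := by
      refine Finset.card_le_card fun q hq => ?_
      obtain ⟨r, hr, hq⟩ := Finset.mem_biUnion.mp hq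
      have hq' := Finset.mem_filter.mp hq
      have hr' := hRmem r hr
      exact Finset.mem_filter.mpr ⟨hq'.1, by omega, by omega⟩

theorem chain_strictMonoOn {β : Type*} [Preorder β] {k : ℕ} {A : ℕ → β}
    (hA : ∀ i, 1 ≤ i → i < k → A i < A (i + 1)) :
    StrictMonoOn A (Finset.Icc 1 k : Set ℕ) := by
  intro i hi j hj hij
  simp only [Finset.coe_Icc, Set.mem_Icc] at hi hj
  induction j, Nat.succ_le_of_lt hij using Nat.le_induction with
  | base => exact hA i hi.1 (by omega)
  | succ n hn ih =>
    exact (ih (by omega) (by omega)).trans (hA n (by omega) (by omega))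

theorem union_eq_union_of_disjoint {α : Type*} [DecidableEq α] {X Y A A' B B' : Finset α}
    (hXY : Disjoint X Y) (hA : A ⊆ X) (hA' : A' ⊆ X) (hB : B ⊆ Y) (hB' : B' ⊆ Y)
    (h : A ∪ B = A' ∪ B') : A = A' ∧ B = B' := by
  have key : ∀ x, x ∈ X → x ∉ Y := fun _ hx => Finset.disjoint_left.mp hXY hx
  have hx : ∀ x, x ∈ A ∨ x ∈ B ↔ x ∈ A' ∨ x ∈ B' := fun x => by
    simpa using Finset.ext_iff.mp h x
  constructor <;> ext x <;> have := hx x <;> have := key x <;> have := @hA x <;>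
    have := @hA' x <;> have := @hB x <;> have := @hB' x <;> tauto

theorem union_free_in_product_of_two_chains {α : Type*} [DecidableEq α]
    (a k : ℕ) (ha : 2 ≤ a) (hk : 1 ≤ k)
    (A B : ℕ → Finset α)
    (hA1 : A 1 ≠ ∅) (hB1 : B 1 ≠ ∅)
    (hA : ∀ i, 1 ≤ i → i < k → A i ⊂ A (i + 1))
    (hB : ∀ i, 1 ≤ i → i < k → B i ⊂ B (i + 1))
    (hdisj : A k ∩ B k = ∅)
    (G : Finset (Finset α))
    (hG : G ⊆ Finset.image (fun p : ℕ × ℕ => A p.1 ∪ B p.2)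
      (Finset.Icc 1 k ×ˢ Finset.Icc 1 k))
    (hGfree : IsUnionFree a G) :
    G.card ≤ 2 * (⌈Real.sqrt ((a : ℝ) + 1)⌉₊ - 1) * k := by
  have hAm := chain_strictMonoOn hA
  have hBm := chain_strictMonoOn hB
  obtain ⟨m, hm⟩ : ∃ m, m = ⌈Real.sqrt ((a : ℝ) + 1)⌉₊ - 1 := ⟨_, rfl⟩
  rw [← hm]
  have hceil : 1 < ⌈Real.sqrt ((a : ℝ) + 1)⌉₊ := by
    rw [Nat.lt_ceil, Nat.cast_one, Real.lt_sqrt zero_le_one]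
    have : (2 : ℝ) ≤ a := by exact_mod_cast ha
    linarith
  have hsq : a + 1 ≤ (m + 1) ^ 2 := by
    have h := Nat.le_ceil (Real.sqrt ((a : ℝ) + 1))
    rw [Real.sqrt_le_left (Nat.cast_nonneg _)] at h
    rw [hm, Nat.sub_add_cancel hceil.le]
    exact_mod_cast h
  by_contra! hlt
  set f : ℕ × ℕ → Finset α := fun p => A p.1 ∪ B p.2 with hf
  set P := (Finset.Icc 1 k ×ˢ Finset.Icc 1 k).filter fun p => f p ∈ G with hPdef
  have hPgrid : P ⊆ Finset.Icc 1 k ×ˢ Finset.Icc 1 k := Finset.filter_subset _ _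
  have hPG : ∀ p ∈ P, f p ∈ G := fun p hp => (Finset.mem_filter.mp hp).2
  have hP1 : ∀ p ∈ P, p.1 ∈ (Finset.Icc 1 k : Set ℕ) := fun p hp =>
    (Finset.mem_product.mp (hPgrid hp)).1
  have hP2 : ∀ p ∈ P, p.2 ∈ (Finset.Icc 1 k : Set ℕ) := fun p hp =>
    (Finset.mem_product.mp (hPgrid hp)).2
  have hkmem : k ∈ (Finset.Icc 1 k : Set ℕ) := by simpa using hk
  have hinj : Set.InjOn f P := by
    intro p hp q hq h
    have hle : ∀ i ∈ (Finset.Icc 1 k : Set ℕ), A i ⊆ A k ∧ B i ⊆ B k := fun i hi =>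
      have hik : i ≤ k := (Finset.mem_Icc.mp hi).2
      ⟨hAm.monotoneOn hi hkmem hik, hBm.monotoneOn hi hkmem hik⟩
    obtain ⟨h1, h2⟩ := union_eq_union_of_disjoint (Finset.disjoint_iff_inter_eq_empty.mpr hdisj)
      (hle _ (hP1 p hp)).1 (hle _ (hP1 q hq)).1 (hle _ (hP2 p hp)).2 (hle _ (hP2 q hq)).2 h
    exact Prod.ext (hAm.injOn (hP1 p hp) (hP1 q hq) h1) (hBm.injOn (hP2 p hp) (hP2 q hq) h2)
  have hGP : G.card ≤ P.card := by
    refine (Finset.card_le_card fun T hT => ?_).trans (Finset.card_image_le (f := f))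
    obtain ⟨p, hp, rfl⟩ := Finset.mem_image.mp (hG hT)
    exact Finset.mem_image_of_mem f (Finset.mem_filter.mpr ⟨hp, hT⟩)
  obtain ⟨t, ht, ⟨u, hu, hu1, hu2⟩, ⟨v, hv, hv2, hv1⟩, hdom⟩ :=
    exists_dominating_point m k (by omega) P hPgrid (hlt.trans_le hGP)
  set D := P.filter fun q => q.1 ≤ t.1 ∧ q.2 ≤ t.2 with hD
  have htD : t ∈ D := Finset.mem_filter.mpr ⟨ht, le_rfl, le_rfl⟩
  have huD : u ∈ D.erase t := Finset.mem_erase.mpr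
    ⟨fun h => hu2.ne (congrArg Prod.snd h), Finset.mem_filter.mpr ⟨hu, hu1.le, hu2.le⟩⟩
  have hvD : v ∈ D.erase t := Finset.mem_erase.mpr
    ⟨fun h => hv1.ne (congrArg Prod.fst h), Finset.mem_filter.mpr ⟨hv, hv1.le, hv2.le⟩⟩
  obtain ⟨S, huvS, hSD, hScard⟩ := Finset.exists_subsuperset_card_eq (s := {u, v})
    (t := D.erase t) (n := a)
    (Finset.insert_subset huD (Finset.singleton_subset_iff.mpr hvD))
    (Finset.card_le_two.trans ha)
    (by rw [Finset.card_erase_of_mem htD]; omega)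
  have hSP : S ⊆ P := hSD.trans ((Finset.erase_subset _ _).trans (Finset.filter_subset _ _))
  refine hGfree (S.image f) ?_ ?_ (f t) (hPG t ht) ?_ ?_
  · exact Finset.image_subset_iff.mpr fun p hp => hPG p (hSP hp)
  · rw [Finset.card_image_of_injOn (hinj.mono (by exact_mod_cast hSP)), hScard]
  · intro h
    obtain ⟨p, hp, hpt⟩ := Finset.mem_image.mp h
    exact (Finset.mem_erase.mp (hSD hp)).1 (hinj (hSP hp) ht hpt)
  · rw [Finset.sup_image, Function.id_comp]
    apply le_antisymm
    · refine Finset.sup_le fun p hp => ?_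
      have hp' := (Finset.mem_filter.mp (Finset.mem_erase.mp (hSD hp)).2).2
      have hpP := hSP hp
      exact Finset.union_subset_union
        (hAm.monotoneOn (hP1 p hpP) (hP1 t ht) hp'.1) (hBm.monotoneOn (hP2 p hpP) (hP2 t ht) hp'.2)
    · have hfu : f u ≤ S.sup f := Finset.le_sup (huvS (by simp))
      have hfv : f v ≤ S.sup f := Finset.le_sup (huvS (by simp))
      refine Finset.union_subset ?_ ?_
      · rw [← hu1]
        exact Finset.subset_union_left.trans hfu
      · rw [← hv2]
        exact Finset.subset_union_right.trans hfv
end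

section
/- Let a ≥ 2, k ≥ 1, and let P be a set of points in the grid [k] × [k]. Suppose there is no point (i,j) ∈ P such that the rectangle R(i,j) = {(x,y) : 1 ≤ x ≤ i, 1 ≤ y ≤ j} contains, apart from (i,j) itself, at least a points of P among which at least one has second coordinate equal to j and at least one has first coordinate equal to i. Then |P| ≤ 2(⌈√(a+1)⌉ − 1) · k. -/
/-- In a finite set with injective coordinates `(f, g)`, at most `t` points of each of the `k`
fibres of `g` have fewer than `t` points of the same fibre before them in the order of `f`. -/
lemma card_filter_few_predecessors_le {α : Type*} (f g : α → ℕ)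
    (hfg : ∀ p q, f p = f q → g p = g q → p = q) (P : Finset α) (t k : ℕ)
    (hg : ∀ p ∈ P, g p ∈ Finset.Icc 1 k) :
    (P.filter (fun p => (P.filter (fun q => g q = g p ∧ f q < f p)).card < t)).card ≤ t * k := by
  have hlt : ∀ p ∈ P, ∀ q, g p = g q → f p < f q →
      (P.filter (fun r => g r = g p ∧ f r < f p)).card <
        (P.filter (fun r => g r = g q ∧ f r < f q)).card := by
    intro p hp q hgpq hfpq
    apply Finset.card_lt_card
    rw [Finset.ssubset_iff_of_subset]
    · exact ⟨p, by simp [hp, hgpq, hfpq], by simp⟩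
    · intro r hr
      simp only [Finset.mem_filter] at hr ⊢
      exact ⟨hr.1, hr.2.1.trans hgpq, hr.2.2.trans hfpq⟩
  have hcard : t * k = (Finset.range t ×ˢ Finset.Icc 1 k).card := by simp
  rw [hcard]
  apply Finset.card_le_card_of_injOn
    (fun p => ((P.filter (fun q => g q = g p ∧ f q < f p)).card, g p))
  · intro p hp
    have hp' := Finset.mem_filter.1 hp
    exact Finset.mem_product.2 ⟨Finset.mem_range.2 hp'.2, hg p hp'.1⟩
  · intro p hp q hq h
    have hp' := (Finset.mem_filter.1 hp).1
    have hq' := (Finset.mem_filter.1 hq).1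
    obtain ⟨h₁, h₂⟩ := Prod.mk.inj h
    rcases lt_trichotomy (f p) (f q) with h' | h' | h'
    · exact absurd h₁ (hlt p hp' q h₂ h').ne
    · exact hfg p q h' h₂
    · exact absurd h₁ (hlt q hq' p h₂.symm h').ne'

/-- If more than `2 * t * k` points are chosen in the `k × k` grid, some chosen point has a chosen
point to its left, one below it, and `(t + 1) ^ 2` chosen points weakly below and to the left. -/
lemma exists_sq_le_card_rectangle (t k : ℕ) (ht : 1 ≤ t) (P : Finset (ℕ × ℕ))
    (hP : P ⊆ Finset.Icc 1 k ×ˢ Finset.Icc 1 k) (hcard : 2 * t * k < P.card) :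
    ∃ p ∈ P, (t + 1) ^ 2 ≤ (P.filter (fun q => q.1 ≤ p.1 ∧ q.2 ≤ p.2)).card ∧
      (∃ q ∈ P, q.2 = p.2 ∧ q.1 < p.1) ∧ ∃ q ∈ P, q.1 = p.1 ∧ q.2 < p.2 := by
  have hrow := card_filter_few_predecessors_le Prod.fst Prod.snd (fun _ _ => Prod.ext) P t k
    fun p hp => (Finset.mem_product.1 (hP hp)).2
  set Q := P.filter (fun p => ¬ (P.filter (fun q => q.2 = p.2 ∧ q.1 < p.1)).card < t) with hQ
  have hcol := card_filter_few_predecessors_le Prod.snd Prod.fst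
    (fun _ _ h₁ h₂ => Prod.ext h₂ h₁) Q t k
    fun p hp => (Finset.mem_product.1 (hP (Finset.mem_filter.1 hp).1)).1
  have hsplit := P.card_filter_add_card_filter_not
    (fun p => (P.filter (fun q => q.2 = p.2 ∧ q.1 < p.1)).card < t)
  rw [← hQ] at hsplit
  obtain ⟨p, hpQ, hp⟩ : ∃ p ∈ Q, t ≤ (Q.filter (fun q => q.1 = p.1 ∧ q.2 < p.2)).card := by
    by_contra! h
    rw [Finset.filter_true_of_mem h] at hcol
    linarith
  have hpP := (Finset.mem_filter.1 hpQ).1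
  have hleft : ∀ q ∈ Q, t ≤ (P.filter (fun r => r.2 = q.2 ∧ r.1 < q.1)).card :=
    fun q hq => not_lt.1 (Finset.mem_filter.1 hq).2
  refine ⟨p, hpP, ?_, ?_, ?_⟩
  · set C := insert p (Q.filter (fun q => q.1 = p.1 ∧ q.2 < p.2)) with hC
    have hCcard : t + 1 ≤ C.card := by
      rw [hC, Finset.card_insert_of_notMem (by simp)]
      lia
    have hCmem : ∀ q ∈ C, q ∈ Q ∧ q.1 = p.1 ∧ q.2 ≤ p.2 := by
      intro q hq
      rcases Finset.mem_insert.1 hq with rfl | hq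
      · exact ⟨hpQ, rfl, le_rfl⟩
      · obtain ⟨h₁, h₂, h₃⟩ := Finset.mem_filter.1 hq
        exact ⟨h₁, h₂, h₃.le⟩
    let L : ℕ × ℕ → Finset (ℕ × ℕ) :=
      fun q => insert q (P.filter (fun r => r.2 = q.2 ∧ r.1 < q.1))
    have hLmem : ∀ q, ∀ r ∈ L q, r.2 = q.2 ∧ r.1 ≤ q.1 := by
      intro q r hr
      rcases Finset.mem_insert.1 hr with rfl | hr
      · exact ⟨rfl, le_rfl⟩
      · exact ⟨(Finset.mem_filter.1 hr).2.1, (Finset.mem_filter.1 hr).2.2.le⟩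
    have hLcard : ∀ q ∈ C, t + 1 ≤ (L q).card := by
      intro q hq
      have := hleft q (hCmem q hq).1
      rw [Finset.card_insert_of_notMem (by simp)]
      lia
    have hdisj : (C : Set (ℕ × ℕ)).PairwiseDisjoint L := by
      intro q hq q' hq' hne
      refine Finset.disjoint_left.2 fun r hr hr' => hne (Prod.ext ?_ ?_)
      · rw [(hCmem q hq).2.1, (hCmem q' hq').2.1]
      · rw [← (hLmem q r hr).1, ← (hLmem q' r hr').1]
    calc (t + 1) ^ 2 = (t + 1) * (t + 1) := sq _
      _ ≤ C.card * (t + 1) := Nat.mul_le_mul_right _ hCcard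
      _ ≤ ∑ q ∈ C, (L q).card := by
        simpa using Finset.card_nsmul_le_sum C _ (t + 1) hLcard
      _ = (C.biUnion L).card := (Finset.card_biUnion hdisj).symm
      _ ≤ _ := by
        refine Finset.card_le_card fun r hr => ?_
        obtain ⟨q, hq, hrq⟩ := Finset.mem_biUnion.1 hr
        obtain ⟨hqQ, h₁, h₂⟩ := hCmem q hq
        obtain ⟨h₃, h₄⟩ := hLmem q r hrq
        refine Finset.mem_filter.2 ⟨?_, h₁ ▸ h₄, h₃ ▸ h₂⟩
        rcases Finset.mem_insert.1 hrq with rfl | hr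
        · exact (Finset.mem_filter.1 hqQ).1
        · exact (Finset.mem_filter.1 hr).1
  · obtain ⟨q, hq⟩ := Finset.card_pos.1 (ht.trans (hleft p hpQ))
    exact ⟨q, Finset.mem_filter.1 hq⟩
  · obtain ⟨q, hq⟩ := Finset.card_pos.1 (ht.trans hp)
    obtain ⟨h₁, h₂⟩ := Finset.mem_filter.1 hq
    exact ⟨q, (Finset.mem_filter.1 h₁).1, h₂⟩

theorem grid_point_set_bound (a k : ℕ) (ha : 2 ≤ a) (hk : 1 ≤ k)
    (P : Finset (ℕ × ℕ)) (hP : P ⊆ Finset.Icc 1 k ×ˢ Finset.Icc 1 k)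
    (hfree : ¬ ∃ i j : ℕ, (i, j) ∈ P ∧
      a ≤ (P.filter (fun p => p ≠ (i, j) ∧ p.1 ≤ i ∧ p.2 ≤ j)).card ∧
      (∃ p ∈ P.filter (fun p => p ≠ (i, j) ∧ p.1 ≤ i ∧ p.2 ≤ j), p.2 = j) ∧
      (∃ p ∈ P.filter (fun p => p ≠ (i, j) ∧ p.1 ≤ i ∧ p.2 ≤ j), p.1 = i)) :
    P.card ≤ 2 * (⌈Real.sqrt ((a : ℝ) + 1)⌉₊ - 1) * k := by
  set s := ⌈Real.sqrt ((a : ℝ) + 1)⌉₊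
  have hs : a + 1 ≤ s ^ 2 := by
    have h := (Real.sqrt_le_left (Nat.cast_nonneg s)).1 (Nat.le_ceil (Real.sqrt ((a : ℝ) + 1)))
    exact_mod_cast h
  have hs2 : 2 ≤ s := by
    by_contra! h
    nlinarith
  by_contra! hcard
  obtain ⟨⟨i, j⟩, hp, hrect, ⟨q, hqP, hq₂, hq₁⟩, ⟨r, hrP, hr₁, hr₂⟩⟩ :=
    exists_sq_le_card_rectangle (s - 1) k (by lia) P hP hcard
  rw [Nat.sub_add_cancel (by lia)] at hrect
  refine hfree ⟨i, j, hp, ?_, ⟨q, ?_, hq₂⟩, ⟨r, ?_, hr₁⟩⟩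
  · have herase : P.filter (fun p => p ≠ (i, j) ∧ p.1 ≤ i ∧ p.2 ≤ j) =
        (P.filter (fun p => p.1 ≤ i ∧ p.2 ≤ j)).erase (i, j) := by
      ext p
      simp only [Finset.mem_filter, Finset.mem_erase]
      tauto
    rw [herase, Finset.card_erase_of_mem (by simp [hp])]
    exact Nat.le_sub_one_of_lt (hs.trans hrect)
  · exact Finset.mem_filter.2 ⟨hqP, fun h => by simp [h] at hq₁, hq₁.le, hq₂.le⟩
  · exact Finset.mem_filter.2 ⟨hrP, fun h => by simp [h] at hr₂, hr₁.le, hr₂.le⟩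
end

section
/- For all integers a ≥ 2, q ≥ 1, k ≥ 1, there exists a family F of q·k² distinct finite sets such that every a-union-free subfamily of F has size less than a − 2 + 2k(⌈√(a+1)⌉ − 1) + (2k − 1)(q − 1). -/
open Finset in
/-- If `g` separates the points of each fibre of `f`, and `f` takes at most `k` values, then at
most `k * r` points have fewer than `r` points of smaller `g`-value in their fibre. -/
theorem card_filter_card_fiber_lt_le {α : Type*} (A : Finset α) (f g : α → ℕ) (k r : ℕ)
    (hf : ∀ p ∈ A, f p < k) (hfg : ∀ p ∈ A, ∀ p' ∈ A, f p = f p' → g p = g p' → p = p') :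
    #{p ∈ A | #{p' ∈ A | f p' = f p ∧ g p' < g p} < r} ≤ k * r := by
  classical
  set U := {p ∈ A | #{p' ∈ A | f p' = f p ∧ g p' < g p} < r}
  have hmaps : ∀ p ∈ U, f p ∈ range k := fun p hp =>
    mem_range.2 (hf p (mem_filter.1 hp).1)
  have hfib : ∀ y ∈ range k, #{p ∈ U | f p = y} ≤ r := by
    intro y _
    rcases ({p ∈ U | f p = y}).eq_empty_or_nonempty with h | h
    · simp [h]
    obtain ⟨p, hp, hmax⟩ := exists_max_image _ g h
    have hpU := (mem_filter.1 hp).1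
    have hpy := (mem_filter.1 hp).2
    have hpA := (mem_filter.1 hpU).1
    have hsub : ({p ∈ U | f p = y}).erase p ⊆ {p' ∈ A | f p' = f p ∧ g p' < g p} := by
      intro s hs
      obtain ⟨hsp, hs⟩ := mem_erase.1 hs
      have hle := hmax s hs
      obtain ⟨hsU, hsy⟩ := mem_filter.1 hs
      have hsA := (mem_filter.1 hsU).1
      refine mem_filter.2 ⟨hsA, hsy.trans hpy.symm, lt_of_le_of_ne hle fun h => ?_⟩
      exact hsp (hfg s hsA p hpA (hsy.trans hpy.symm) h)
    have h1 := card_le_card hsub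
    have h2 := (mem_filter.1 hpU).2
    have h3 := card_erase_add_one hp
    omega
  simpa [mul_comm] using card_le_mul_card_image_of_maps_to hmaps r hfib

/-- The union of the initial segment of length `u` of the even numbers and the initial segment of
length `v` of the odd numbers. -/
def parityBox (u v : ℕ) : Finset ℕ :=
  (Finset.range u).image (fun x => 2 * x) ∪ (Finset.range v).image (fun x => 2 * x + 1)

theorem even_mem_parityBox {u v x : ℕ} : 2 * x ∈ parityBox u v ↔ x < u := by
  simp only [parityBox, Finset.mem_union, Finset.mem_image, Finset.mem_range]
  constructor
  · rintro (⟨y, hy, h⟩ | ⟨y, hy, h⟩) <;> omega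
  · exact fun h => Or.inl ⟨x, h, rfl⟩

theorem odd_mem_parityBox {u v x : ℕ} : 2 * x + 1 ∈ parityBox u v ↔ x < v := by
  simp only [parityBox, Finset.mem_union, Finset.mem_image, Finset.mem_range]
  constructor
  · rintro (⟨y, hy, h⟩ | ⟨y, hy, h⟩) <;> omega
  · exact fun h => Or.inr ⟨x, h, rfl⟩

theorem parityBox_subset_iff {u v u' v' : ℕ} :
    parityBox u v ⊆ parityBox u' v' ↔ u ≤ u' ∧ v ≤ v' := by
  constructor
  · intro h
    constructor
    · by_contra! hlt
      exact lt_irrefl _ (even_mem_parityBox.1 (h (even_mem_parityBox.2 hlt)))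
    · by_contra! hlt
      exact lt_irrefl _ (odd_mem_parityBox.1 (h (odd_mem_parityBox.2 hlt)))
  · rintro ⟨hu, hv⟩
    exact Finset.union_subset_union (Finset.image_subset_image (Finset.range_mono hu))
      (Finset.image_subset_image (Finset.range_mono hv))

theorem parityBox_subset_union {u v u' v' : ℕ} :
    parityBox u v ⊆ parityBox u v' ∪ parityBox u' v :=
  Finset.union_subset
    (Finset.subset_union_left.trans Finset.subset_union_left)
    (Finset.subset_union_right.trans Finset.subset_union_right)

/-- The set with coordinates `(i, j)` in layer `l` of the construction, the triple being
`(l, i, j)`. -/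
def layeredSet (k : ℕ) (t : ℕ × ℕ × ℕ) : Finset ℕ :=
  parityBox (t.1 * k + t.2.1) (t.1 * k + t.2.2)

/-- The index set of the construction: `q` layers, each a `k × k` grid. -/
def layeredGrid (q k : ℕ) : Finset (ℕ × ℕ × ℕ) :=
  Finset.range q ×ˢ Finset.range k ×ˢ Finset.range k

theorem mem_layeredGrid {q k : ℕ} {t : ℕ × ℕ × ℕ} :
    t ∈ layeredGrid q k ↔ t.1 < q ∧ t.2.1 < k ∧ t.2.2 < k := by
  simp [layeredGrid]

theorem layeredSet_injOn (q k : ℕ) :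
    Set.InjOn (layeredSet k) (layeredGrid q k : Set (ℕ × ℕ × ℕ)) := by
  rintro ⟨l, i, j⟩ ht ⟨l', i', j'⟩ ht' h
  obtain ⟨-, hi, hj⟩ := mem_layeredGrid.1 ht
  obtain ⟨-, hi', hj'⟩ := mem_layeredGrid.1 ht'
  obtain ⟨h1, h2⟩ := parityBox_subset_iff.1 h.subset
  obtain ⟨h3, h4⟩ := parityBox_subset_iff.1 h.symm.subset
  dsimp only at *
  have hl : l = l' := by
    rcases lt_trichotomy l l' with hlt | heq | hlt
    · have := Nat.mul_le_mul_right k (Nat.succ_le_of_lt hlt)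
      rw [Nat.succ_mul] at this
      omega
    · exact heq
    · have := Nat.mul_le_mul_right k (Nat.succ_le_of_lt hlt)
      rw [Nat.succ_mul] at this
      omega
  subst hl
  simp only [Prod.mk.injEq, true_and]
  omega

theorem layeredSet_subset_of_layer_lt {q k : ℕ} {s t : ℕ × ℕ × ℕ} (hs : s ∈ layeredGrid q k)
    (h : s.1 < t.1) : layeredSet k s ⊆ layeredSet k t := by
  obtain ⟨-, hi, hj⟩ := mem_layeredGrid.1 hs
  have := Nat.mul_le_mul_right k (Nat.succ_le_of_lt h)
  rw [Nat.succ_mul] at this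
  exact parityBox_subset_iff.2 ⟨by omega, by omega⟩

theorem layeredSet_subset_of_le {k : ℕ} {s t : ℕ × ℕ × ℕ} (h : s.1 = t.1)
    (hi : s.2.1 ≤ t.2.1) (hj : s.2.2 ≤ t.2.2) : layeredSet k s ⊆ layeredSet k t :=
  parityBox_subset_iff.2 ⟨by rw [h]; omega, by rw [h]; omega⟩

open Finset in
/-- In an `a`-union free family, a set that is the union of two others contains fewer than `a`
other members of the family. -/
theorem card_lt_of_isUnionFree {a q k : ℕ} (ha : 2 ≤ a) {A W : Finset (ℕ × ℕ × ℕ)}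
    (hA : A ⊆ layeredGrid q k) (hG : IsUnionFree a (A.image (layeredSet k)))
    {t x y : ℕ × ℕ × ℕ} (ht : t ∈ A) (hx : x ∈ W) (hy : y ∈ W)
    (hx1 : x.1 = t.1) (hxi : x.2.1 = t.2.1) (hxj : x.2.2 < t.2.2)
    (hy1 : y.1 = t.1) (hyj : y.2.2 = t.2.2)
    (hWA : W ⊆ A) (htW : t ∉ W) (hW : ∀ s ∈ W, layeredSet k s ⊆ layeredSet k t) :
    #W < a := by
  by_contra! hlt
  have hpair : ({x, y} : Finset _) ⊆ W := by
    intro s hs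
    rcases mem_insert.1 hs with rfl | hs
    · exact hx
    · rw [mem_singleton.1 hs]; exact hy
  obtain ⟨S, hxyS, hSW, hS⟩ := exists_subsuperset_card_eq hpair (card_le_two.trans ha) hlt
  have hinj := layeredSet_injOn q k
  have hSA := hSW.trans hWA
  refine hG (S.image (layeredSet k)) (image_subset_image hSA) ?_ (layeredSet k t)
    (mem_image_of_mem _ ht) ?_ ?_
  · rw [card_image_of_injOn (hinj.mono (by exact_mod_cast hSA.trans hA)), hS]
  · intro h
    obtain ⟨s, hs, hst⟩ := mem_image.1 h
    have := hinj (hA (hSA hs)) (hA ht) hst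
    exact htW (this ▸ hSW hs)
  · apply le_antisymm
    · refine Finset.sup_le fun X hX => ?_
      obtain ⟨s, hs, rfl⟩ := mem_image.1 hX
      exact hW s (hSW hs)
    · have hX : ∀ s ∈ S, layeredSet k s ⊆ (S.image (layeredSet k)).sup id := fun s hs =>
        Finset.le_sup (f := id) (mem_image_of_mem _ hs)
      refine Subset.trans ?_ (union_subset (hX x (hxyS (by simp))) (hX y (hxyS (by simp))))
      unfold layeredSet
      rw [hx1, hxi, hy1, hyj]
      exact parityBox_subset_union

open Finset in
theorem card_layer_le_of_isUnionFree {a q k d : ℕ} (ha : 2 ≤ a) (hd : 1 ≤ d)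
    (had : a + 1 ≤ (d + 1) ^ 2) {A : Finset (ℕ × ℕ × ℕ)} (hA : A ⊆ layeredGrid q k)
    (hG : IsUnionFree a (A.image (layeredSet k))) (l : ℕ) :
    #{t ∈ A | t.1 = l} ≤ 2 * k * d := by
  by_contra! hlt
  set B := {t ∈ A | t.1 = l}
  have hBA : B ⊆ A := filter_subset _ _
  have hBl : ∀ t ∈ B, t.1 = l := fun t ht => (mem_filter.1 ht).2
  have hgrid : ∀ t ∈ B, t.1 < q ∧ t.2.1 < k ∧ t.2.2 < k := fun t ht =>
    mem_layeredGrid.1 (hA (hBA ht))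
  have hext : ∀ s ∈ B, ∀ t ∈ B, s.2.1 = t.2.1 → s.2.2 = t.2.2 → s = t := fun s hs t ht h h' =>
    Prod.ext ((hBl s hs).trans (hBl t ht).symm) (Prod.ext h h')
  have hU := card_filter_card_fiber_lt_le B (fun t => t.2.1) (fun t => t.2.2) k d
    (fun t ht => (hgrid t ht).2.1) hext
  set p : ℕ × ℕ × ℕ → Prop := fun t => #{s ∈ B | s.2.1 = t.2.1 ∧ s.2.2 < t.2.2} < d
  set C := {t ∈ B | ¬ p t}
  have hCB : C ⊆ B := filter_subset _ _
  have hV := card_filter_card_fiber_lt_le C (fun t => t.2.2) (fun t => t.2.1) k d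
    (fun t ht => (hgrid t (hCB ht)).2.2)
    (fun s hs t ht h h' => hext s (hCB hs) t (hCB ht) h' h)
  have hsplit : #(B.filter p) + #C = #B := card_filter_add_card_filter_not p
  have hkd : 2 * k * d = k * d + k * d := by ring
  have hC_lt : #{t ∈ C | #{s ∈ C | s.2.2 = t.2.2 ∧ s.2.1 < t.2.1} < d} < #C := by
    have : #(B.filter p) ≤ k * d := hU
    omega
  obtain ⟨t, htC, htV⟩ := exists_mem_notMem_of_card_lt_card hC_lt
  have hrow : d ≤ #{s ∈ C | s.2.2 = t.2.2 ∧ s.2.1 < t.2.1} := by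
    by_contra! h
    exact htV (mem_filter.2 ⟨htC, h⟩)
  have hcol : ∀ s ∈ C, d ≤ #{s' ∈ B | s'.2.1 = s.2.1 ∧ s'.2.2 < s.2.2} := fun s hs =>
    not_lt.1 (mem_filter.1 hs).2
  have htB := hCB htC
  obtain ⟨x, hx⟩ := card_pos.1 (hd.trans (hcol t htC))
  obtain ⟨y, hy⟩ := card_pos.1 (hd.trans hrow)
  obtain ⟨hxB, hxi, hxj⟩ := mem_filter.1 hx
  obtain ⟨hyC, hyj, hyi⟩ := mem_filter.1 hy
  have hyB := hCB hyC
  set W := {s ∈ B | s.2.1 ≤ t.2.1 ∧ s.2.2 ≤ t.2.2}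
  have htW : t ∈ W := mem_filter.2 ⟨htB, le_rfl, le_rfl⟩
  have hWB : W ⊆ B := filter_subset _ _
  have hcard : #(W.erase t) < a := by
    refine card_lt_of_isUnionFree ha hA hG (hBA htB) (x := x) (y := y)
      (mem_erase.2 ⟨?_, mem_filter.2 ⟨hxB, hxi.le, hxj.le⟩⟩)
      (mem_erase.2 ⟨?_, mem_filter.2 ⟨hyB, hyi.le, hyj.le⟩⟩)
      ((hBl x hxB).trans (hBl t htB).symm) hxi hxj
      ((hBl y hyB).trans (hBl t htB).symm) hyj
      ((erase_subset _ _).trans (hWB.trans hBA)) (notMem_erase _ _) ?_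
    · rintro rfl; exact lt_irrefl _ hxj
    · rintro rfl; exact lt_irrefl _ hyi
    · intro s hs
      obtain ⟨hsB, hsi, hsj⟩ := mem_filter.1 (mem_of_mem_erase hs)
      exact layeredSet_subset_of_le ((hBl s hsB).trans (hBl t htB).symm) hsi hsj
  set R := insert t {s ∈ C | s.2.2 = t.2.2 ∧ s.2.1 < t.2.1} with hR
  have hRprop : ∀ s ∈ R, s ∈ C ∧ s.2.2 = t.2.2 ∧ s.2.1 ≤ t.2.1 := by
    intro s hs
    rcases mem_insert.1 hs with rfl | hs
    · exact ⟨htC, rfl, le_rfl⟩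
    · obtain ⟨h1, h2, h3⟩ := mem_filter.1 hs
      exact ⟨h1, h2, h3.le⟩
  have hRcard : d + 1 ≤ #R := by
    rw [hR, card_insert_of_notMem (by simp)]
    omega
  have hRimage : #(R.image fun s => s.2.1) = #R := by
    refine card_image_of_injOn fun s hs s' hs' h => ?_
    obtain ⟨h1, h2, -⟩ := hRprop s hs
    obtain ⟨h1', h2', -⟩ := hRprop s' hs'
    exact hext s (hCB h1) s' (hCB h1') h (h2.trans h2'.symm)
  have hfib : ∀ i ∈ R.image fun s => s.2.1, d + 1 ≤ #{w ∈ W | w.2.1 = i} := by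
    intro i hi
    obtain ⟨s, hs, rfl⟩ := mem_image.1 hi
    obtain ⟨hsC, hsj, hsi⟩ := hRprop s hs
    have hsub : insert s {s' ∈ B | s'.2.1 = s.2.1 ∧ s'.2.2 < s.2.2} ⊆
        {w ∈ W | w.2.1 = s.2.1} := by
      intro w hw
      rcases mem_insert.1 hw with rfl | hw
      · exact mem_filter.2 ⟨mem_filter.2 ⟨hCB hsC, hsi, hsj.le⟩, rfl⟩
      · obtain ⟨h1, h2, h3⟩ := mem_filter.1 hw
        exact mem_filter.2 ⟨mem_filter.2 ⟨h1, h2.le.trans hsi, h3.le.trans hsj.le⟩, h2⟩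
    have h1 := card_le_card hsub
    rw [card_insert_of_notMem (by simp)] at h1
    have h2 := hcol s hsC
    omega
  have hW : (d + 1) * (d + 1) ≤ #W := by
    calc (d + 1) * (d + 1) ≤ ∑ _i ∈ R.image fun s => s.2.1, (d + 1) := by
          rw [sum_const, hRimage, smul_eq_mul]
          exact Nat.mul_le_mul_right _ hRcard
      _ ≤ ∑ i ∈ R.image fun s => s.2.1, #{w ∈ W | w.2.1 = i} := sum_le_sum hfib
      _ = #{w ∈ W | w.2.1 ∈ R.image fun s => s.2.1} := sum_card_fiberwise_eq_card_filter _ _ _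
      _ ≤ #W := card_filter_le _ _
  have h3 := card_erase_add_one htW
  rw [sq] at had
  omega

open Finset in
theorem card_layer_le_of_le_card_lower {a q k : ℕ} (ha : 2 ≤ a) (hk : 1 ≤ k)
    {A : Finset (ℕ × ℕ × ℕ)} (hA : A ⊆ layeredGrid q k)
    (hG : IsUnionFree a (A.image (layeredSet k))) (l : ℕ) (hl : a ≤ #{t ∈ A | t.1 < l} + 2) :
    #{t ∈ A | t.1 = l} ≤ 2 * k - 1 := by
  set B := {t ∈ A | t.1 = l}
  have hBA : B ⊆ A := filter_subset _ _
  have hBl : ∀ t ∈ B, t.1 = l := fun t ht => (mem_filter.1 ht).2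
  have hgrid : ∀ t ∈ B, t.1 < q ∧ t.2.1 < k ∧ t.2.2 < k := fun t ht =>
    mem_layeredGrid.1 (hA (hBA ht))
  have hext : ∀ s ∈ B, ∀ t ∈ B, s.2.1 = t.2.1 → s.2.2 = t.2.2 → s = t := fun s hs t ht h h' =>
    Prod.ext ((hBl s hs).trans (hBl t ht).symm) (Prod.ext h h')
  have hU := card_filter_card_fiber_lt_le B (fun t => t.2.1) (fun t => t.2.2) k 1
    (fun t ht => (hgrid t ht).2.1) hext
  set p : ℕ × ℕ × ℕ → Prop := fun t => #{s ∈ B | s.2.1 = t.2.1 ∧ s.2.2 < t.2.2} < 1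
  have hsplit : #(B.filter p) + #{t ∈ B | ¬ p t} = #B := card_filter_add_card_filter_not p
  have hbelow : ∀ t ∈ ({t ∈ B | ¬ p t} : Finset _),
      ∃ x ∈ B, x.2.1 = t.2.1 ∧ x.2.2 < t.2.2 := by
    intro t ht
    obtain ⟨x, hx⟩ := card_pos.1 (not_lt.1 (mem_filter.1 ht).2)
    exact ⟨x, mem_filter.1 hx⟩
  have hleft : ∀ t ∈ ({t ∈ B | ¬ p t} : Finset _), ∀ y ∈ B, y.2.2 = t.2.2 →
      ¬ y.2.1 < t.2.1 := by
    intro t ht y hyB hyj hyi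
    obtain ⟨x, hxB, hxi, hxj⟩ := hbelow t ht
    have htB := (mem_filter.1 ht).1
    set L := {s ∈ A | s.1 < l}
    have hLl : ∀ s ∈ L, s.1 < l := fun s hs => (mem_filter.1 hs).2
    have hLA : L ⊆ A := filter_subset _ _
    have hyL : y ∉ L := fun h => (hLl y h).ne (hBl y hyB)
    have hxL : x ∉ insert y L := by
      intro h
      rcases mem_insert.1 h with rfl | h
      · omega
      · exact (hLl x h).ne (hBl x hxB)
    have hcard : #(insert x (insert y L)) < a := by
      refine card_lt_of_isUnionFree ha hA hG (hBA htB) (x := x) (y := y) (by simp) (by simp)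
        ((hBl x hxB).trans (hBl t htB).symm) hxi hxj
        ((hBl y hyB).trans (hBl t htB).symm) hyj
        (insert_subset (hBA hxB) (insert_subset (hBA hyB) hLA)) ?_ ?_
      · intro h
        rcases mem_insert.1 h with rfl | h
        · omega
        rcases mem_insert.1 h with rfl | h
        · omega
        exact (hLl t h).ne (hBl t htB)
      · intro s hs
        rcases mem_insert.1 hs with rfl | hs
        · exact layeredSet_subset_of_le ((hBl s hxB).trans (hBl t htB).symm) hxi.le hxj.le
        rcases mem_insert.1 hs with rfl | hs
        · exact layeredSet_subset_of_le ((hBl s hyB).trans (hBl t htB).symm) hyi.le hyj.le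
        exact layeredSet_subset_of_layer_lt (hA (hLA hs)) ((hLl s hs).trans_eq (hBl t htB).symm)
    rw [card_insert_of_notMem hxL, card_insert_of_notMem hyL] at hcard
    omega
  have hV : #{t ∈ B | ¬ p t} ≤ #(Ico 1 k) := by
    refine card_le_card_of_injOn (fun t => t.2.2) (fun t ht => ?_) fun s hs t ht h => ?_
    · obtain ⟨x, -, -, hxj⟩ := hbelow t ht
      have := (hgrid t (mem_filter.1 ht).1).2.2
      simp only [coe_Ico, Set.mem_Ico]
      omega
    · have hsB := (mem_filter.1 hs).1
      have htB := (mem_filter.1 ht).1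
      have h1 := hleft s hs t htB h.symm
      have h2 := hleft t ht s hsB h
      exact hext s hsB t htB (by omega) h
  rw [Nat.card_Ico] at hV
  have : #(B.filter p) ≤ k * 1 := hU
  omega

open Finset in
theorem card_lower_lt_of_isUnionFree {a q k d : ℕ} (ha : 2 ≤ a) (hk : 1 ≤ k) (hd : 1 ≤ d)
    (had : a + 1 ≤ (d + 1) ^ 2) {A : Finset (ℕ × ℕ × ℕ)} (hA : A ⊆ layeredGrid q k)
    (hG : IsUnionFree a (A.image (layeredSet k))) (m : ℕ) :
    #{t ∈ A | t.1 < m + 1} + 2 < a + 2 * k * d + (2 * k - 1) * m := by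
  have hsucc : ∀ l, #{t ∈ A | t.1 < l + 1} = #{t ∈ A | t.1 < l} + #{t ∈ A | t.1 = l} := by
    intro l
    rw [← card_union_of_disjoint (disjoint_filter.2 fun t _ h h' => h.ne h'), ← filter_or]
    congr 1
    ext t
    simp only [mem_filter, Nat.lt_succ_iff_lt_or_eq]
  have hkd : 2 * k ≤ 2 * k * d := Nat.le_mul_of_pos_right _ hd
  induction m with
  | zero =>
    have h1 := card_layer_le_of_isUnionFree ha hd had hA hG 0
    have h2 := card_layer_le_of_le_card_lower ha hk hA hG 0
    have h3 := hsucc 0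
    have h4 : #{t ∈ A | t.1 < 0} = 0 := by simp
    omega
  | succ m ih =>
    have h1 := card_layer_le_of_isUnionFree ha hd had hA hG (m + 1)
    have h2 := card_layer_le_of_le_card_lower ha hk hA hG (m + 1)
    have h3 := hsucc (m + 1)
    rw [mul_add_one]
    omega

theorem union_free_layered_construction (a q k : ℕ) (ha : 2 ≤ a) (hq : 1 ≤ q) (hk : 1 ≤ k) :
    ∃ F : Finset (Finset ℕ), F.card = q * k ^ 2 ∧
      ∀ G ⊆ F, IsUnionFree a G →
        (G.card : ℝ) < (a : ℝ) - 2 + 2 * k * ((⌈Real.sqrt ((a : ℝ) + 1)⌉₊ : ℝ) - 1)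
          + (2 * (k : ℝ) - 1) * ((q : ℝ) - 1) := by
  refine ⟨(layeredGrid q k).image (layeredSet k), ?_, fun G hGF hG => ?_⟩
  · rw [Finset.card_image_of_injOn (layeredSet_injOn q k)]
    simp [layeredGrid, sq]
  obtain ⟨A, hA, rfl⟩ := Finset.subset_image_iff.1 hGF
  have hA : A ⊆ layeredGrid q k := by exact_mod_cast hA
  have hceil := Nat.le_ceil (Real.sqrt ((a : ℝ) + 1))
  obtain ⟨m, rfl⟩ := Nat.exists_eq_add_of_le' hq
  generalize ⌈Real.sqrt ((a : ℝ) + 1)⌉₊ = c at hceil ⊢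
  have hc : a + 1 ≤ c ^ 2 := by
    have := (Real.sqrt_le_left (Nat.cast_nonneg c)).1 hceil
    exact_mod_cast this
  have hc2 : 2 ≤ c := by nlinarith
  obtain ⟨d, rfl⟩ := Nat.exists_eq_add_of_le' (one_le_two.trans hc2)
  have hlt := card_lower_lt_of_isUnionFree ha hk (by omega) hc hA hG m
  have hall : A.filter (fun t => t.1 < m + 1) = A :=
    Finset.filter_true_of_mem fun t ht => (mem_layeredGrid.1 (hA ht)).1
  rw [hall] at hlt
  have hle : ((A.image (layeredSet k)).card : ℝ) ≤ A.card := by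
    exact_mod_cast Finset.card_image_le
  have hcast : (A.card : ℝ) + 2 < a + 2 * k * d + (2 * k - 1) * m := by
    have h : ((A.card + 2 : ℕ) : ℝ) < ((a + 2 * k * d + (2 * k - 1) * m : ℕ) : ℝ) := by
      exact_mod_cast hlt
    push_cast [Nat.cast_sub (show 1 ≤ 2 * k by omega)] at h
    exact h
  push_cast
  simp only [add_sub_cancel_right]
  linarith
end

section
/- For every integer a ≥ 2 and every positive integer m, there exists a family F of m distinct finite sets such that every a-union-free subfamily of F has size at most 4a + 4·a^{1/4}·√m. -/
/-- At most `r` points of each fibre of `f` have `g`-rank at most `r` inside the fibre. -/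
theorem card_filter_rank_le {α : Type*} (P : Finset α) (f g : α → ℕ) (r : ℕ) :
    (P.filter fun x => (P.filter fun y => f y = f x ∧ g y ≤ g x).card ≤ r).card
      ≤ r * (P.image f).card := by
  refine (Finset.card_le_mul_card_image _ r fun b _ => ?_).trans
    (Nat.mul_le_mul_left r (Finset.card_le_card
      (Finset.image_subset_image (Finset.filter_subset _ P))))
  rcases Finset.eq_empty_or_nonempty ((P.filter fun x =>
    (P.filter fun y => f y = f x ∧ g y ≤ g x).card ≤ r).filter fun x => f x = b) with h | h
  · rw [h]
    simp
  · obtain ⟨x, hx, hmax⟩ := Finset.exists_max_image _ g h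
    simp only [Finset.mem_filter] at hx hmax
    refine le_trans (Finset.card_le_card fun y hy => ?_) hx.1.2
    simp only [Finset.mem_filter] at hy ⊢
    exact ⟨hy.1.1, hy.2.trans hx.2.symm, hmax y hy⟩

/-- A dense subset of a grid has a point which is the join of two smaller points of the subset
and dominates at least `(r + 1) ^ 2` points of the subset. -/
theorem exists_sup_eq_of_card_lt {P : Finset (ℕ × ℕ)} {I J : Finset ℕ} (hP : P ⊆ I ×ˢ J)
    {r : ℕ} (hr : 1 ≤ r) (h : r * I.card + r * J.card < P.card) :
    ∃ T ∈ P, ∃ u ∈ P, ∃ v ∈ P, u < T ∧ v < T ∧ u ⊔ v = T ∧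
      (r + 1) ^ 2 ≤ (P.filter fun x => x ≤ T).card := by
  classical
  set Q := P.filter fun x => ¬ (P.filter fun y => y.1 = x.1 ∧ y.2 ≤ x.2).card ≤ r with hQ
  have hQP : Q ⊆ P := Finset.filter_subset _ _
  have h1 := card_filter_rank_le P Prod.fst Prod.snd r
  have h2 := card_filter_rank_le Q Prod.snd Prod.fst r
  have hI : (P.image Prod.fst).card ≤ I.card := Finset.card_le_card fun i hi => by
    obtain ⟨x, hx, rfl⟩ := Finset.mem_image.1 hi
    exact (Finset.mem_product.1 (hP hx)).1
  have hJ : (Q.image Prod.snd).card ≤ J.card := Finset.card_le_card fun i hi => by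
    obtain ⟨x, hx, rfl⟩ := Finset.mem_image.1 hi
    exact (Finset.mem_product.1 (hP (hQP hx))).2
  have h3 := Finset.card_filter_add_card_filter_not (s := P)
    (fun x => (P.filter fun y => y.1 = x.1 ∧ y.2 ≤ x.2).card ≤ r)
  rw [← hQ] at h3
  have h4 : (Q.filter fun x => (Q.filter fun y => y.2 = x.2 ∧ y.1 ≤ x.1).card ≤ r).card
      < Q.card := by
    have := Nat.mul_le_mul_left r hI
    have := Nat.mul_le_mul_left r hJ
    omega
  obtain ⟨T, hTQ, hT⟩ : ∃ T ∈ Q, r < (Q.filter fun y => y.2 = T.2 ∧ y.1 ≤ T.1).card := by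
    by_contra! hcon
    exact h4.ne (congrArg Finset.card (Finset.filter_true_of_mem hcon))
  have hcol : ∀ x ∈ Q, r < (P.filter fun y => y.1 = x.1 ∧ y.2 ≤ x.2).card := fun x hx =>
    not_le.1 (Finset.mem_filter.1 hx).2
  obtain ⟨u, hu, huT⟩ := Finset.exists_mem_ne (hr.trans_lt hT) T
  obtain ⟨v, hv, hvT⟩ := Finset.exists_mem_ne (hr.trans_lt (hcol T hTQ)) T
  simp only [Finset.mem_filter] at hu hv
  refine ⟨T, hQP hTQ, u, hQP hu.1, v, hv.1,
    lt_of_le_of_ne ⟨hu.2.2, hu.2.1.le⟩ huT, lt_of_le_of_ne ⟨hv.2.1.le, hv.2.2⟩ hvT, ?_, ?_⟩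
  · exact Prod.ext (by simp [hv.2.1, hu.2.2]) (by simp [hu.2.1, hv.2.2])
  · set R := Q.filter fun y => y.2 = T.2 ∧ y.1 ≤ T.1
    have hdisj : (R : Set (ℕ × ℕ)).PairwiseDisjoint
        fun x => P.filter fun y => y.1 = x.1 ∧ y.2 ≤ x.2 := by
      intro x hx y hy hxy
      refine Finset.disjoint_left.2 fun z hzx hzy => hxy ?_
      simp only [Finset.mem_filter] at hzx hzy
      have hx' := (Finset.mem_filter.1 (Finset.mem_coe.1 hx)).2
      have hy' := (Finset.mem_filter.1 (Finset.mem_coe.1 hy)).2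
      exact Prod.ext (hzx.2.1.symm.trans hzy.2.1) (hx'.1.trans hy'.1.symm)
    calc (r + 1) ^ 2 = (r + 1) * (r + 1) := sq _
      _ ≤ R.card * (r + 1) := Nat.mul_le_mul_right _ hT
      _ ≤ ∑ x ∈ R, (P.filter fun y => y.1 = x.1 ∧ y.2 ≤ x.2).card := by
        rw [← smul_eq_mul]
        exact Finset.card_nsmul_le_sum _ _ _ fun x hx => hcol x (Finset.mem_filter.1 hx).1
      _ = (R.biUnion fun x => P.filter fun y => y.1 = x.1 ∧ y.2 ≤ x.2).card :=
        (Finset.card_biUnion hdisj).symm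
      _ ≤ _ := by
        refine Finset.card_le_card fun z hz => ?_
        obtain ⟨x, hx, hzx⟩ := Finset.mem_biUnion.1 hz
        have hx' := (Finset.mem_filter.1 hx).2
        simp only [Finset.mem_filter] at hzx ⊢
        exact ⟨hzx.1, hzx.2.1.le.trans hx'.2, hzx.2.2.trans hx'.1.le⟩

/-- The `k`-th diagonal block of side `s` in `ℕ × ℕ`. -/
def diagBlock (s k : ℕ) : Finset (ℕ × ℕ) :=
  Finset.Ico (k * s) (k * s + s) ×ˢ Finset.Ico (k * s) (k * s + s)

theorem card_diagBlock (s k : ℕ) : (diagBlock s k).card = s * s := by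
  simp [diagBlock]

theorem lt_of_mem_diagBlock {s k l : ℕ} (hkl : k < l) {x y : ℕ × ℕ} (hx : x ∈ diagBlock s k)
    (hy : y ∈ diagBlock s l) : x.1 < y.1 ∧ x.2 < y.2 := by
  simp only [diagBlock, Finset.mem_product, Finset.mem_Ico] at hx hy
  have h : (k + 1) * s ≤ l * s := Nat.mul_le_mul_right s hkl
  rw [add_mul, one_mul] at h
  omega

theorem pairwise_disjoint_diagBlock (s : ℕ) : Pairwise (Function.onFun Disjoint (diagBlock s)) := by
  intro k l hkl
  refine Finset.disjoint_left.2 fun x hk hl => ?_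
  rcases lt_or_gt_of_ne hkl with h | h
  · exact (lt_of_mem_diagBlock h hk hl).1.ne rfl
  · exact (lt_of_mem_diagBlock h hl hk).1.ne rfl

theorem card_inter_biUnion_diagBlock_le {a r s : ℕ} (hr : 1 ≤ r) (har : a < (r + 1) ^ 2)
    {H : Finset (ℕ × ℕ)}
    (hH : ∀ T ∈ H, ∀ u ∈ H, ∀ v ∈ H, u < T → v < T → u ⊔ v = T →
      (H.filter fun x => x ≤ T).card ≤ a) (n : ℕ) :
    (H ∩ (Finset.range n).biUnion (diagBlock s)).card ≤ a + 2 * (r * s) + 2 * s * n := by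
  induction n with
  | zero => simp
  | succ n ih =>
    set L := H ∩ (Finset.range n).biUnion (diagBlock s)
    have hsplit : H ∩ (Finset.range (n + 1)).biUnion (diagBlock s)
        = (H ∩ diagBlock s n) ∪ L := by
      rw [Finset.range_add_one, Finset.biUnion_insert, Finset.inter_union_distrib_left]
    have hunion := Finset.card_union_le (H ∩ diagBlock s n) L
    rw [hsplit]
    have hPH : H ∩ diagBlock s n ⊆ H := Finset.inter_subset_left
    rcases lt_or_ge L.card a with hLa | hLa
    · have hP : (H ∩ diagBlock s n).card ≤ 2 * (r * s) := by
        by_contra! hlt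
        obtain ⟨T, hT, u, hu, v, hv, huT, hvT, huv, hcard⟩ :=
          exists_sup_eq_of_card_lt (P := H ∩ diagBlock s n) Finset.inter_subset_right hr
            (by simp only [Nat.card_Ico, Nat.add_sub_cancel_left]; omega)
        have h1 := hH T (hPH hT) u (hPH hu) v (hPH hv) huT hvT huv
        have h2 := Finset.card_le_card (Finset.filter_subset_filter (fun x => x ≤ T) hPH)
        omega
      omega
    · have hP : (H ∩ diagBlock s n).card ≤ 2 * s := by
        by_contra! hlt
        obtain ⟨T, hT, u, hu, v, hv, huT, hvT, huv, -⟩ :=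
          exists_sup_eq_of_card_lt (P := H ∩ diagBlock s n) Finset.inter_subset_right le_rfl
            (by simp only [Nat.card_Ico, Nat.add_sub_cancel_left]; omega)
        have h1 := hH T (hPH hT) u (hPH hu) v (hPH hv) huT hvT huv
        have hlow : ∀ x ∈ L, x.1 < T.1 ∧ x.2 < T.2 := by
          intro x hx
          obtain ⟨k, hk, hxk⟩ := Finset.mem_biUnion.1 (Finset.mem_inter.1 hx).2
          exact lt_of_mem_diagBlock (Finset.mem_range.1 hk) hxk (Finset.mem_inter.1 hT).2
        have hTL : T ∉ L := fun h => (hlow T h).1.ne rfl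
        have h2 : (insert T L).card ≤ (H.filter fun x => x ≤ T).card := by
          refine Finset.card_le_card fun x hx => ?_
          rcases Finset.mem_insert.1 hx with rfl | hx
          · exact Finset.mem_filter.2 ⟨hPH hT, le_rfl⟩
          · exact Finset.mem_filter.2
              ⟨(Finset.mem_inter.1 hx).1, (hlow x hx).1.le, (hlow x hx).2.le⟩
        rw [Finset.card_insert_of_notMem hTL] at h2
        omega
      have : 2 * s * (n + 1) = 2 * s * n + 2 * s := by ring
      omega

/-- The union of initial segments of lengths `x.1` and `x.2` of two disjoint copies of `ℕ`,
placed inside `ℕ`. -/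
def initialPair (x : ℕ × ℕ) : Finset ℕ :=
  ((Finset.range x.1).disjSum (Finset.range x.2)).map Equiv.natSumNatEquivNat.toEmbedding

theorem initialPair_subset_iff {x y : ℕ × ℕ} : initialPair x ⊆ initialPair y ↔ x ≤ y := by
  simp only [initialPair, Finset.map_subset_map]
  constructor
  · intro h
    refine ⟨Finset.range_subset_range.1 fun i hi => ?_, Finset.range_subset_range.1 fun i hi => ?_⟩
    · exact Finset.inl_mem_disjSum.1 (h (Finset.inl_mem_disjSum.2 hi))
    · exact Finset.inr_mem_disjSum.1 (h (Finset.inr_mem_disjSum.2 hi))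
  · exact fun h => Finset.disjSum_mono (Finset.range_subset_range.2 h.1)
      (Finset.range_subset_range.2 h.2)

theorem initialPair_injective : Function.Injective initialPair := fun _ _ h =>
  le_antisymm (initialPair_subset_iff.1 h.subset) (initialPair_subset_iff.1 h.symm.subset)

theorem initialPair_sup_subset (x y : ℕ × ℕ) :
    initialPair (x ⊔ y) ⊆ initialPair x ∪ initialPair y := by
  rw [initialPair, initialPair, initialPair, ← Finset.map_union, Finset.map_subset_map]
  rintro (i | i) hi <;>
  simpa [Finset.inl_mem_disjSum, Finset.inr_mem_disjSum] using hi

theorem IsUnionFree.card_filter_le {a : ℕ} (ha : 2 ≤ a) {H : Finset (ℕ × ℕ)}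
    (hH : IsUnionFree a (H.image initialPair)) {T u v : ℕ × ℕ} (hT : T ∈ H) (hu : u ∈ H)
    (hv : v ∈ H) (huT : u < T) (hvT : v < T) (huv : u ⊔ v = T) :
    (H.filter fun x => x ≤ T).card ≤ a := by
  by_contra! hlt
  have hTmem : T ∈ H.filter fun x => x ≤ T := Finset.mem_filter.2 ⟨hT, le_rfl⟩
  have hcard : a ≤ ((H.filter fun x => x ≤ T).erase T).card := by
    rw [Finset.card_erase_of_mem hTmem]
    omega
  have hsub : {u, v} ⊆ (H.filter fun x => x ≤ T).erase T := by
    intro x hx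
    rcases Finset.mem_insert.1 hx with rfl | hx
    · exact Finset.mem_erase.2 ⟨huT.ne, Finset.mem_filter.2 ⟨hu, huT.le⟩⟩
    · rw [Finset.mem_singleton.1 hx]
      exact Finset.mem_erase.2 ⟨hvT.ne, Finset.mem_filter.2 ⟨hv, hvT.le⟩⟩
  obtain ⟨S, huvS, hSD, hSa⟩ :=
    Finset.exists_subsuperset_card_eq hsub (Finset.card_le_two.trans ha) hcard
  have hS : ∀ x ∈ S, x ≠ T ∧ x ∈ H ∧ x ≤ T := fun x hx => by
    simpa [Finset.mem_erase, Finset.mem_filter] using hSD hx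
  refine hH (S.image initialPair) (Finset.image_subset_image fun x hx => (hS x hx).2.1)
    ((Finset.card_image_of_injective _ initialPair_injective).trans hSa) (initialPair T)
    (Finset.mem_image_of_mem _ hT) ?_ (le_antisymm ?_ ?_)
  · rw [initialPair_injective.mem_finset_image]
    exact fun h => (hS T h).1 rfl
  · refine Finset.sup_le fun X hX => ?_
    obtain ⟨x, hx, rfl⟩ := Finset.mem_image.1 hX
    exact initialPair_subset_iff.2 (hS x hx).2.2
  · have hle : ∀ x ∈ S, initialPair x ≤ (S.image initialPair).sup id := fun x hx =>
      Finset.le_sup (f := id) (Finset.mem_image_of_mem _ hx)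
    rw [← huv]
    exact (initialPair_sup_subset u v).trans
      (Finset.union_subset (hle u (huvS (by simp))) (hle v (huvS (by simp))))

theorem union_free_upper_bound (a : ℕ) (ha : 2 ≤ a) (m : ℕ) (hm : 0 < m) :
    ∃ F : Finset (Finset ℕ), F.card = m ∧
      ∀ G ⊆ F, IsUnionFree a G →
        (G.card : ℝ) ≤ 4 * (a : ℝ) + 4 * (a : ℝ) ^ ((1 : ℝ) / 4) * Real.sqrt m := by
  set r := Nat.sqrt a
  have hr : 1 ≤ r := Nat.sqrt_pos.2 (by omega)
  have har : a < (r + 1) ^ 2 := Nat.lt_succ_sqrt' a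
  have hra : r ^ 2 ≤ a := Nat.sqrt_le' a
  have hr0 : (0 : ℝ) < r := by exact_mod_cast hr
  set s := ⌈Real.sqrt (m / r)⌉₊
  have hs1 : Real.sqrt (m / r) ≤ s := Nat.le_ceil _
  have hs2 : (s : ℝ) < Real.sqrt (m / r) + 1 := Nat.ceil_lt_add_one (Real.sqrt_nonneg _)
  have hmcard : m ≤ ((Finset.range r).biUnion (diagBlock s)).card := by
    rw [Finset.card_biUnion fun k _ l _ hkl => pairwise_disjoint_diagBlock s hkl]
    simp only [card_diagBlock, Finset.sum_const, Finset.card_range, smul_eq_mul]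
    have h := (Real.sqrt_le_left (Nat.cast_nonneg s)).1 hs1
    rw [div_le_iff₀ hr0] at h
    have h' : (m : ℝ) ≤ ((r * (s * s) : ℕ) : ℝ) := by
      push_cast
      linarith
    exact_mod_cast h'
  obtain ⟨E, hE, hEm⟩ := Finset.exists_subset_card_eq hmcard
  refine ⟨E.image initialPair,
    (Finset.card_image_of_injective _ initialPair_injective).trans hEm, fun G hG hfree => ?_⟩
  obtain ⟨H, hHE, rfl⟩ := Finset.subset_image_iff.1 hG
  have hbound := card_inter_biUnion_diagBlock_le (s := s) hr har
    (fun T hT u hu v hv => hfree.card_filter_le ha hT hu hv) r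
  rw [Finset.inter_eq_left.2 ((Finset.coe_subset.1 hHE).trans hE)] at hbound
  rw [Finset.card_image_of_injective _ initialPair_injective]
  have hcast : (H.card : ℝ) ≤ a + 4 * (r * s) := by
    have : H.card ≤ a + 4 * (r * s) := hbound.trans_eq (by ring)
    exact_mod_cast this
  have hra' : (r : ℝ) ^ 2 ≤ a := by exact_mod_cast hra
  have hroot : (r : ℝ) * Real.sqrt (m / r) ≤ (a : ℝ) ^ ((1 : ℝ) / 4) * Real.sqrt m := by
    have h1 : (r : ℝ) * Real.sqrt (m / r) = Real.sqrt r * Real.sqrt m := by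
      rw [Real.sqrt_div (Nat.cast_nonneg m)]
      have := Real.mul_self_sqrt hr0.le
      have := (Real.sqrt_pos.2 hr0).ne'
      field_simp
      nlinarith
    have h2 : Real.sqrt r ≤ (a : ℝ) ^ ((1 : ℝ) / 4) := by
      calc Real.sqrt r ≤ Real.sqrt (Real.sqrt a) := Real.sqrt_le_sqrt (Real.le_sqrt_of_sq_le hra')
        _ = (a : ℝ) ^ ((1 : ℝ) / 4) := by
          rw [Real.sqrt_eq_rpow, Real.sqrt_eq_rpow, ← Real.rpow_mul (Nat.cast_nonneg a)]
          norm_num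
    rw [h1]
    exact mul_le_mul_of_nonneg_right h2 (Real.sqrt_nonneg _)
  have h4r : 4 * (r : ℝ) ≤ 3 * a := by
    have : 4 * r ≤ 3 * a := by
      rcases hr.eq_or_lt with h | h
      · omega
      · nlinarith
    exact_mod_cast this
  have hrs : (r : ℝ) * s ≤ r * Real.sqrt (m / r) + r := by
    nlinarith
  linarith
end
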